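/- arXiv:2208.10055 — 2 statements merged into one kernel-verified Lean document; each statement's English description precedes it below -/
import Mathlib

section
/- Let f: ℝ^m → ℝ^n be a polynomial map with m > n and let δ_{S'} be an s-arc at t_0 on a stratum S' ∈ 𝔖_{t_0}, parametrized by an embedding γ: [0,1] → ℝ^n with γ(0) = t_0. If the restriction f: f^{-1}(δ_{S'}) → δ_{S'} has a non-trivial vanishing i-cycle g, then π_{i+1}(f, δ_{S'}, x_0) ≠ 1, where x_0 is any point in the connected component of f^{-1}(t_0) intersecting the image g(S^i × {0}). -/
open scoped unitInterval
open Set Filter Topology Metric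

noncomputable section

/-! ### Cubes and relative homotopy groups -/

/-- The `n`-dimensional unit cube `I^n = [0,1]^n`. -/
abbrev Cube (n : ℕ) := Fin n → I

/-- The subset `J_{i+1} = ∂ I^{i+1} ∖ (Int I^i × {0})` of the cube `I^{i+1}`;
the last coordinate plays the role of the distinguished (base-face) coordinate. -/
def JSet (i : ℕ) : Set (Cube (i + 1)) :=
  {p | (∃ j, p j = 0 ∨ p j = 1) ∧
    ¬(p (Fin.last i) = 0 ∧ ∀ j : Fin i, p j.castSucc ≠ 0 ∧ p j.castSucc ≠ 1)}

/-- A continuous map `h : I^{i+1} → A` with `h(I^i × {0}) ⊆ B` and `h(J_{i+1}) = {x0}`,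
i.e. the maps representing elements of the relative homotopy group `π_{i+1}(A, B, x0)`. -/
structure IsRelMap {X : Type*} [TopologicalSpace X] (i : ℕ) (A B : Set X) (x0 : X)
    (h : Cube (i + 1) → X) : Prop where
  continuous : Continuous h
  mem_total : ∀ p, h p ∈ A
  mem_base : ∀ p : Cube (i + 1), p (Fin.last i) = 0 → h p ∈ B
  eq_base_pt : ∀ p ∈ JSet i, h p = x0

/-- Homotopy of two representing maps through maps of the same form. -/
def RelHomotopic {X : Type*} [TopologicalSpace X] (i : ℕ) (A B : Set X) (x0 : X)
    (h₀ h₁ : Cube (i + 1) → X) : Prop :=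
  ∃ H : Cube (i + 1) × I → X, Continuous H ∧
    (∀ τ : I, IsRelMap i A B x0 fun p => H (p, τ)) ∧
    (∀ p, H (p, 0) = h₀ p) ∧ ∀ p, H (p, 1) = h₁ p

/-- `π_{i+1}(A, B, x0) = 1`: every representing map is homotopic, through maps of the same
form, to a map with image contained in `B`. -/
def RelPiTrivial {X : Type*} [TopologicalSpace X] (i : ℕ) (A B : Set X) (x0 : X) : Prop :=
  ∀ h : Cube (i + 1) → X, IsRelMap i A B x0 h →
    ∃ h' : Cube (i + 1) → X, IsRelMap i A B x0 h' ∧ (∀ p, h' p ∈ B) ∧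
      RelHomotopic i A B x0 h h'

/-- The set of homotopy classes forming the relative homotopy group `π_{i+1}(A, B, x0)`. -/
def RelPi {X : Type*} [TopologicalSpace X] (i : ℕ) (A B : Set X) (x0 : X) : Type _ :=
  Quot fun h₁ h₂ : {h : Cube (i + 1) → X // IsRelMap i A B x0 h} =>
    RelHomotopic i A B x0 h₁.1 h₂.1

theorem IsRelMap.mono {X : Type*} [TopologicalSpace X] {i : ℕ} {A A' B B' : Set X} {x0 : X}
    {h : Cube (i + 1) → X} (hh : IsRelMap i A B x0 h) (hA : A ⊆ A') (hB : B ⊆ B') :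
    IsRelMap i A' B' x0 h :=
  ⟨hh.continuous, fun p => hA (hh.mem_total p), fun p hp => hB (hh.mem_base p hp),
    hh.eq_base_pt⟩

theorem RelHomotopic.mono {X : Type*} [TopologicalSpace X] {i : ℕ} {A A' B B' : Set X}
    {x0 : X} {h₀ h₁ : Cube (i + 1) → X} (hr : RelHomotopic i A B x0 h₀ h₁)
    (hA : A ⊆ A') (hB : B ⊆ B') : RelHomotopic i A' B' x0 h₀ h₁ := by
  obtain ⟨H, hc, hsl, h0, h1⟩ := hr
  exact ⟨H, hc, fun τ => (hsl τ).mono hA hB, h0, h1⟩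

/-- The map of relative homotopy groups induced by an inclusion of pairs `(A,B) ⊆ (A',B')`. -/
def RelPi.incl {X : Type*} [TopologicalSpace X] {i : ℕ} {A A' B B' : Set X} {x0 : X}
    (hA : A ⊆ A') (hB : B ⊆ B') : RelPi i A B x0 → RelPi i A' B' x0 :=
  Quot.map (fun h => ⟨h.1, h.2.mono hA hB⟩) fun _ _ hr => hr.mono hA hB

/-! ### Serre fibrations, locally trivial fibrations, s-arcs -/

/-- A continuous surjection `p : E → B` is a Serre fibration if it has the homotopy lifting
property with respect to all finite-dimensional cubes. -/
def IsSerreFibration {E B : Type*} [TopologicalSpace E] [TopologicalSpace B]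
    (p : E → B) : Prop :=
  Continuous p ∧ Function.Surjective p ∧
    ∀ (k : ℕ) (H : Cube k × I → B) (h : Cube k → E),
      Continuous H → Continuous h → (∀ q, p (h q) = H (q, 0)) →
      ∃ G : Cube k × I → E, Continuous G ∧ (∀ q, p (G q) = H q) ∧ ∀ q, G (q, 0) = h q

/-- `f` is a locally trivial fibration over `S`: every `t ∈ S` has a neighborhood `V ∩ S`
in `S` such that `f ⁻¹' (V ∩ S)` is homeomorphic to `(V ∩ S) × f ⁻¹' {t}` over `f`. -/
def IsLocTrivOn {E B : Type*} [TopologicalSpace E] [TopologicalSpace B]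
    (f : E → B) (S : Set B) : Prop :=
  ∀ t ∈ S, ∃ V : Set B, IsOpen V ∧ t ∈ V ∧
    ∃ φ : ↥(f ⁻¹' (V ∩ S)) ≃ₜ ↥(V ∩ S) × ↥(f ⁻¹' {t}), ∀ x, ((φ x).1 : B) = f (x : E)

/-- `δ` is an s-arc on `S` at `t0`: the image of an embedding `γ : [0,1] → B` with
`γ 0 = t0` and `γ((0,1]) ⊆ S`. -/
def IsSArc {B : Type*} [TopologicalSpace B] (S : Set B) (t0 : B) (δ : Set B) : Prop :=
  ∃ γ : I → B, Continuous γ ∧ Function.Injective γ ∧ γ 0 = t0 ∧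
    (∀ s : I, s ≠ 0 → γ s ∈ S) ∧ δ = Set.range γ

/-- `f` has no vanishing component at `t0`: for every embedded arc `γ` starting at `t0`
over whose image minus `t0` the map `f` is a locally trivial fibration, every connected
component of `f ⁻¹' (γ((0,1]))` has closure meeting the fiber `f ⁻¹' {t0}`. -/
def NoVanishingComponent {E B : Type*} [TopologicalSpace E] [TopologicalSpace B]
    (f : E → B) (t0 : B) : Prop :=
  ∀ γ : I → B, Continuous γ → Function.Injective γ → γ 0 = t0 →
    IsLocTrivOn f (γ '' {s : I | s ≠ 0}) →
    ∀ x ∈ f ⁻¹' (γ '' {s : I | s ≠ 0}),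
      (closure (connectedComponentIn (f ⁻¹' (γ '' {s : I | s ≠ 0})) x) ∩
        f ⁻¹' {t0}).Nonempty

/-! ### Polynomial maps and semialgebraic sets -/

/-- A polynomial map `ℝ^m → ℝ^n`: each component is (the evaluation of) a real
polynomial in `m` variables. -/
def IsPolyMap {m n : ℕ} (f : EuclideanSpace ℝ (Fin m) → EuclideanSpace ℝ (Fin n)) : Prop :=
  ∀ j : Fin n, ∃ P : MvPolynomial (Fin m) ℝ, ∀ x, f x j = MvPolynomial.eval (fun k => x k) P

/-- Semialgebraic subsets of `ℝ^n`. -/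
inductive IsSemialgebraic {n : ℕ} : Set (EuclideanSpace ℝ (Fin n)) → Prop
  | zeroSet (P : MvPolynomial (Fin n) ℝ) :
      IsSemialgebraic {x | MvPolynomial.eval (fun j => x j) P = 0}
  | posSet (P : MvPolynomial (Fin n) ℝ) :
      IsSemialgebraic {x | 0 < MvPolynomial.eval (fun j => x j) P}
  | union {s t : Set (EuclideanSpace ℝ (Fin n))} :
      IsSemialgebraic s → IsSemialgebraic t → IsSemialgebraic (s ∪ t)
  | inter {s t : Set (EuclideanSpace ℝ (Fin n))} :
      IsSemialgebraic s → IsSemialgebraic t → IsSemialgebraic (s ∩ t)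
  | compl {s : Set (EuclideanSpace ℝ (Fin n))} :
      IsSemialgebraic s → IsSemialgebraic sᶜ

/-! ### Spheres, vanishing and emerging cycles -/

/-- The `i`-dimensional sphere, realized as the unit sphere in `ℝ^{i+1}`. -/
def SphS (i : ℕ) : Set (EuclideanSpace ℝ (Fin (i + 1))) := Metric.sphere 0 1

/-- The base point of the `i`-dimensional sphere. -/
def spherePt (i : ℕ) : ↥(SphS i) := ⟨EuclideanSpace.single 0 1, by simp [SphS]⟩

/-- A map `h : Z → E` is null-homotopic in `A ⊆ E` (its image being contained in `A`)
if it is homotopic within `A` to a constant map. -/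
def NullHomotopicIn {Z E : Type*} [TopologicalSpace Z] [TopologicalSpace E]
    (h : Z → E) (A : Set E) : Prop :=
  ∃ (H : Z × I → E) (c : E), Continuous H ∧ (∀ q, H q ∈ A) ∧
    (∀ z, H (z, 0) = h z) ∧ ∀ z, H (z, 1) = c

/-- Two maps `h₀ h₁ : Z → E` are (freely) homotopic in `A ⊆ E`. -/
def HomotopicIn {Z E : Type*} [TopologicalSpace Z] [TopologicalSpace E]
    (h₀ h₁ : Z → E) (A : Set E) : Prop :=
  ∃ H : Z × I → E, Continuous H ∧ (∀ q, H q ∈ A) ∧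
    (∀ z, H (z, 0) = h₀ z) ∧ ∀ z, H (z, 1) = h₁ z

/-- Two maps `h₀ h₁ : Z → E` are homotopic in `A ⊆ E` relative to the base point `z0`. -/
def HomotopicInRel {Z E : Type*} [TopologicalSpace Z] [TopologicalSpace E]
    (h₀ h₁ : Z → E) (A : Set E) (z0 : Z) : Prop :=
  ∃ H : Z × I → E, Continuous H ∧ (∀ q, H q ∈ A) ∧
    (∀ z, H (z, 0) = h₀ z) ∧ (∀ z, H (z, 1) = h₁ z) ∧ ∀ τ, H (z0, τ) = h₀ z0

/-- A vanishing `i`-cycle of `f` over the parametrized arc `γ`: a fibered map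
`g : S^i × [0,1] → E` over `γ` such that `g(·,s)` is null-homotopic in the fiber
`f ⁻¹' {γ s}` for every `s > 0`. -/
def IsVanishingCycle {E B : Type*} [TopologicalSpace E] [TopologicalSpace B]
    (f : E → B) (γ : I → B) (i : ℕ) (g : ↥(SphS i) × I → E) : Prop :=
  Continuous g ∧ (∀ x s, f (g (x, s)) = γ s) ∧
    ∀ s : I, s ≠ 0 → NullHomotopicIn (fun x => g (x, s)) (f ⁻¹' {γ s})

/-- A vanishing cycle is trivial if `g(·,0)` is also null-homotopic in `f ⁻¹' {γ 0}`. -/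
def VanishingCycleTrivial {E B : Type*} [TopologicalSpace E] [TopologicalSpace B]
    (f : E → B) (γ : I → B) (i : ℕ) (g : ↥(SphS i) × I → E) : Prop :=
  NullHomotopicIn (fun x => g (x, 0)) (f ⁻¹' {γ 0})

/-- An emerging `i`-cycle of `f` over the parametrized arc `γ`: a fibered map
`g : S^i × (0,1] → E` over `γ` such that the base point image `g(x₀,s)` has a limit
as `s → 0`. -/
def IsEmergingCycle {E B : Type*} [TopologicalSpace E] [TopologicalSpace B]
    (f : E → B) (γ : I → B) (i : ℕ) (g : ↥(SphS i) × {s : I // s ≠ 0} → E) : Prop :=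
  Continuous g ∧ (∀ x s, f (g (x, s)) = γ s.1) ∧
    ∃ L : E, Filter.Tendsto (fun s : {s : I // s ≠ 0} => g (spherePt i, s))
      (Filter.comap Subtype.val (𝓝[≠] (0 : I))) (𝓝 L)

/-- An emerging cycle is trivial if it agrees near `0`, up to fiberwise base-point
preserving homotopy, with a fibered map defined on `S^i × [0,ε)`. -/
def EmergingCycleTrivial {E B : Type*} [TopologicalSpace E] [TopologicalSpace B]
    (f : E → B) (γ : I → B) (i : ℕ) (g : ↥(SphS i) × {s : I // s ≠ 0} → E) : Prop :=
  ∃ ε : I, ε ≠ 0 ∧ ∃ g' : ↥(SphS i) × {s : I // (s : ℝ) < (ε : ℝ)} → E,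
    Continuous g' ∧ (∀ x s, f (g' (x, s)) = γ s.1) ∧
      ∀ (s : {s : I // s ≠ 0}) (hs : ((s : I) : ℝ) < (ε : ℝ)),
        g' (spherePt i, ⟨s.1, hs⟩) = g (spherePt i, s) ∧
        HomotopicInRel (fun x => g (x, s)) (fun x => g' (x, ⟨s.1, hs⟩))
          (f ⁻¹' {γ s.1}) (spherePt i)

/-- Paths in the ambient space that are finite concatenations of segments, the ends of each of
which lie in a common preconnected subset of `Z` of diameter at most `ε`. -/
inductive ChainPath {E : Type*} [NormedAddCommGroup E] [NormedSpace ℝ E] (Z : Set E) (ε : ℝ) :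
    ∀ {a b : E}, Path a b → Prop
  | segment {a b : E} (C : Set E) (hC : IsPreconnected C) (hCZ : C ⊆ Z)
      (hd : ∀ u ∈ C, ∀ v ∈ C, dist u v ≤ ε) (ha : a ∈ C) (hb : b ∈ C) :
      ChainPath Z ε (Path.segment a b)
  | trans {a b c : E} {p : Path a b} {q : Path b c} :
      ChainPath Z ε p → ChainPath Z ε q → ChainPath Z ε (p.trans q)

/-- Every point of `Z` has arbitrarily small preconnected neighbourhoods in `Z`. -/
def HasSmallPreconnectedNhds {E : Type*} [PseudoMetricSpace E] (Z : Set E) : Prop :=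
  ∀ x ∈ Z, ∀ ε > 0, ∃ C ⊆ Z, IsPreconnected C ∧ x ∈ C ∧ C ⊆ closedBall x ε ∧ C ∈ 𝓝[Z] x

section
variable {E : Type*} [NormedAddCommGroup E] [NormedSpace ℝ E] {Z : Set E}

theorem Path.segment_mem_of_convex {K : Set E} (hK : Convex ℝ K) {a b : E} (ha : a ∈ K)
    (hb : b ∈ K) (t : I) : Path.segment a b t ∈ K := by
  have : Path.segment a b t ∈ Set.range (Path.segment a b) := ⟨t, rfl⟩
  rw [Path.range_segment] at this
  exact hK.segment_subset ha hb this

theorem exists_chainPath (hZ : HasSmallPreconnectedNhds Z) {ε : ℝ} (hε : 0 < ε) {C K : Set E}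
    (hC : IsPreconnected C) (hCZ : C ⊆ Z) (hK : Convex ℝ K) (hCK : C ⊆ K) {a b : E}
    (ha : a ∈ C) (hb : b ∈ C) :
    ∃ p : Path a b, ChainPath Z ε p ∧ ∀ t, p t ∈ K := by
  refine hC.induction₂' (fun x y => ∃ p : Path x y, ChainPath Z ε p ∧ ∀ t, p t ∈ K)
    (fun x hx => ?_) ?_ ha hb
  · obtain ⟨N, hNZ, hN, hxN, hNb, hNn⟩ := hZ x (hCZ hx) (ε / 2) (by positivity)
    have hd : ∀ u ∈ N, ∀ v ∈ N, dist u v ≤ ε := fun u hu v hv => by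
      have h1 := mem_closedBall.1 (hNb hu)
      have h2 := mem_closedBall.1 (hNb hv)
      linarith [dist_triangle_right u v x]
    filter_upwards [nhdsWithin_mono x hCZ hNn, self_mem_nhdsWithin] with y hyN hyC
    exact ⟨⟨_, .segment N hN hNZ hd hxN hyN,
        Path.segment_mem_of_convex hK (hCK hx) (hCK hyC)⟩,
      ⟨_, .segment N hN hNZ hd hyN hxN, Path.segment_mem_of_convex hK (hCK hyC) (hCK hx)⟩⟩
  · rintro x y z - - - ⟨p, hp, hpK⟩ ⟨q, hq, hqK⟩
    refine ⟨p.trans q, hp.trans hq, fun t => ?_⟩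
    rw [Path.trans_apply]
    split_ifs
    exacts [hpK _, hqK _]

theorem ChainPath.exists_mem_dist_le {ε : ℝ} {a b : E} {p : Path a b} (hp : ChainPath Z ε p)
    (t : I) : ∃ z ∈ Z, dist (p t) z ≤ ε := by
  induction hp generalizing t with
  | @segment a b C hC hCZ hd ha hb =>
    exact ⟨a, hCZ ha, mem_closedBall.1 (Path.segment_mem_of_convex (convex_closedBall a ε)
      (mem_closedBall.2 (hd a ha a ha)) (mem_closedBall.2 (hd b hb a ha)) t)⟩
  | trans _ _ ihp ihq =>
    rw [Path.trans_apply]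
    split_ifs
    exacts [ihp _, ihq _]

theorem ChainPath.exists_refinement (hZ : HasSmallPreconnectedNhds Z) {ε ε' : ℝ} (hε' : 0 < ε')
    {a b : E} {p : Path a b} (hp : ChainPath Z ε p) :
    ∃ q : Path a b, ChainPath Z ε' q ∧ ∀ t, dist (p t) (q t) ≤ 2 * ε := by
  induction hp with
  | @segment a b C hC hCZ hd ha hb =>
    have hCb : C ⊆ closedBall a ε := fun u hu => mem_closedBall.2 (hd u hu a ha)
    obtain ⟨q, hq, hqb⟩ := exists_chainPath hZ hε' hC hCZ (convex_closedBall a ε) hCb ha hb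
    refine ⟨q, hq, fun t => ?_⟩
    have h1 := mem_closedBall.1 (hqb t)
    have h2 := mem_closedBall.1
      (Path.segment_mem_of_convex (convex_closedBall a ε) (hCb ha) (hCb hb) t)
    linarith [dist_triangle_right (Path.segment a b t) (q t) a]
  | trans _ _ ihp ihq =>
    obtain ⟨p', hp', hpd⟩ := ihp
    obtain ⟨q', hq', hqd⟩ := ihq
    refine ⟨p'.trans q', hp'.trans hq', fun t => ?_⟩
    rw [Path.trans_apply, Path.trans_apply]
    split_ifs
    exacts [hpd _, hqd _]

/-- A form of the Mazurkiewicz–Moore–Menger theorem: in a closed locally connected subset of a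
Banach space, points of a common preconnected subset are joined by a path. -/
theorem IsPreconnected.joinedIn_of_hasSmallPreconnectedNhds [CompleteSpace E] (hZc : IsClosed Z)
    (hZ : HasSmallPreconnectedNhds Z) {C : Set E} (hC : IsPreconnected C) (hCZ : C ⊆ Z) {a b : E}
    (ha : a ∈ C) (hb : b ∈ C) : JoinedIn Z a b := by
  have hpos : ∀ k : ℕ, (0 : ℝ) < (1 / 2) ^ k := fun k => by positivity
  choose next hnext hdist using fun (k : ℕ) (p : {p : Path a b // ChainPath Z ((1 / 2) ^ k) p}) =>
    p.2.exists_refinement hZ (hpos (k + 1))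
  obtain ⟨p₀, hp₀, -⟩ := exists_chainPath hZ (hpos 0) hC hCZ convex_univ (subset_univ C) ha hb
  let P : ∀ k : ℕ, {p : Path a b // ChainPath Z ((1 / 2) ^ k) p} := fun k =>
    Nat.rec ⟨p₀, hp₀⟩ (fun k p => ⟨next k p, hnext k p⟩) k
  have hP : ∀ k t, dist ((P k).1 t) ((P (k + 1)).1 t) ≤ 2 * (1 / 2) ^ k := fun k t =>
    hdist k (P k) t
  have hcau : CauchySeq fun k => (P k).1.toContinuousMap :=
    cauchySeq_of_le_geometric (1 / 2) 2 (by norm_num) fun k =>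
      (ContinuousMap.dist_le (by positivity)).2 fun t => hP k t
  obtain ⟨F, hF⟩ := cauchySeq_tendsto_of_complete hcau
  have hFt : ∀ t, Tendsto (fun k => (P k).1 t) atTop (𝓝 (F t)) := fun t =>
    ((continuous_eval_const t).tendsto F).comp hF
  refine ⟨⟨F, ?_, ?_⟩, fun t => ?_⟩
  · exact tendsto_nhds_unique (hFt 0) (by simp)
  · exact tendsto_nhds_unique (hFt 1) (by simp)
  · choose z hzZ hz using fun k => (P k).2.exists_mem_dist_le t
    refine hZc.mem_of_tendsto (b := atTop) (f := z) ?_ (Eventually.of_forall hzZ)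
    refine tendsto_of_tendsto_of_dist (hFt t) ?_
    exact squeeze_zero (fun _ => dist_nonneg) hz
      (tendsto_pow_atTop_nhds_zero_of_lt_one (by norm_num) (by norm_num))
end

/-- Being a finite union of preconnected sets. -/
def IsFiniteUnionPreconnected {X : Type*} [TopologicalSpace X] (V : Set X) : Prop :=
  ∃ 𝒞 : Set (Set X), 𝒞.Finite ∧ (∀ C ∈ 𝒞, IsPreconnected C) ∧ ⋃₀ 𝒞 = V

section
variable {X Y : Type*} [TopologicalSpace X] [TopologicalSpace Y]

theorem IsFiniteUnionPreconnected.union {V W : Set X} (hV : IsFiniteUnionPreconnected V)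
    (hW : IsFiniteUnionPreconnected W) : IsFiniteUnionPreconnected (V ∪ W) := by
  obtain ⟨𝒞, hf, hc, rfl⟩ := hV
  obtain ⟨𝒟, hf', hc', rfl⟩ := hW
  exact ⟨𝒞 ∪ 𝒟, hf.union hf', fun C hC => hC.elim (hc C) (hc' C), sUnion_union _ _⟩

theorem Set.Finite.isFiniteUnionPreconnected {V : Set X} (hV : V.Finite) :
    IsFiniteUnionPreconnected V :=
  ⟨(fun x => {x}) '' V, hV.image _, by rintro _ ⟨x, -, rfl⟩; exact isPreconnected_singleton,
    by simp⟩

theorem IsFiniteUnionPreconnected.image {V : Set X} (hV : IsFiniteUnionPreconnected V) {φ : X → Y}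
    (hφ : Continuous φ) : IsFiniteUnionPreconnected (φ '' V) := by
  obtain ⟨𝒞, hf, hc, rfl⟩ := hV
  refine ⟨(φ '' ·) '' 𝒞, hf.image _, ?_, ?_⟩
  · rintro _ ⟨C, hC, rfl⟩
    exact (hc C hC).image _ hφ.continuousOn
  · rw [sUnion_image, sUnion_eq_biUnion, image_iUnion₂]

theorem IsFiniteUnionPreconnected.of_subset {V W : Set X} (hW : IsFiniteUnionPreconnected W)
    (hWV : W ⊆ V) (hmeet : ∀ x ∈ V, (connectedComponentIn V x ∩ W).Nonempty) :
    IsFiniteUnionPreconnected V := by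
  obtain ⟨𝒞, hf, hc, rfl⟩ := hW
  refine ⟨(fun C => ⋃ x ∈ C, connectedComponentIn V x) '' 𝒞, hf.image _, ?_, ?_⟩
  · rintro _ ⟨C, hC, rfl⟩
    rcases C.eq_empty_or_nonempty with rfl | ⟨y, hy⟩
    · simpa using isPreconnected_empty
    · have : ⋃ x ∈ C, connectedComponentIn V x = connectedComponentIn V y := by
        refine Subset.antisymm (iUnion₂_subset fun x hx => ?_)
          (subset_biUnion_of_mem (u := fun x => connectedComponentIn V x) hy)
        have hCV : C ⊆ V := (subset_sUnion_of_mem hC).trans hWV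
        exact (connectedComponentIn_eq ((hc C hC).subset_connectedComponentIn hx hCV hy)).subset
      dsimp only
      rw [this]
      exact isPreconnected_connectedComponentIn
  · refine Subset.antisymm ?_ fun x hx => ?_
    · rintro z ⟨_, ⟨C, hC, rfl⟩, hz⟩
      obtain ⟨x, hx, hzx⟩ := mem_iUnion₂.1 hz
      exact connectedComponentIn_subset V x hzx
    · obtain ⟨y, hyx, C, hC, hyC⟩ := hmeet x hx
      refine ⟨_, ⟨C, hC, rfl⟩, mem_iUnion₂.2 ⟨y, hyC, ?_⟩⟩
      rw [← connectedComponentIn_eq hyx]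
      exact mem_connectedComponentIn hx

theorem IsFiniteUnionPreconnected.connectedComponentIn_mem_nhdsWithin {V : Set X}
    (hV : IsFiniteUnionPreconnected V) (hVc : IsClosed V) (x : X) :
    connectedComponentIn V x ∈ 𝓝[V] x := by
  obtain ⟨𝒞, hf, hc, hU⟩ := hV
  have hsub : ∀ C ∈ 𝒞, closure C ⊆ V := fun C hC =>
    closure_minimal (hU ▸ subset_sUnion_of_mem hC) hVc
  have hev : ∀ᶠ y in 𝓝 x, ∀ C ∈ 𝒞, x ∉ closure C → y ∉ closure C := by
    rw [eventually_all_finite hf]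
    intro C hC
    by_cases h : x ∈ closure C
    · exact Eventually.of_forall fun _ h' => absurd h h'
    · filter_upwards [isClosed_closure.isOpen_compl.mem_nhds h] with y hy _ using hy
  filter_upwards [nhdsWithin_le_nhds hev, self_mem_nhdsWithin] with y hy hyV
  obtain ⟨C, hC, hyC⟩ := hU.symm ▸ hyV
  by_cases h : x ∈ closure C
  · exact (hc C hC).closure.subset_connectedComponentIn h (hsub C hC) (subset_closure hyC)
  · exact absurd (subset_closure hyC) (hy C hC h)
end

open scoped nonZeroDivisors in
theorem MvPolynomial.isAlgebraic_or_exists_derivation {ι : Type} [Finite ι]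
    (P : Ideal (MvPolynomial ι ℝ)) [P.IsPrime] :
    (∀ j, IsAlgebraic ℝ (Ideal.Quotient.mk P (X j))) ∨
      ∃ D : Derivation ℝ (MvPolynomial ι ℝ) (MvPolynomial ι ℝ),
        (∀ q ∈ P, D q ∈ P) ∧ ∃ j, D (X j) ∉ P := by
  let A := MvPolynomial ι ℝ ⧸ P
  let K := FractionRing A
  have hinj : Function.Injective (algebraMap A K) := IsFractionRing.injective A K
  have hess : Algebra.EssFiniteType ℝ K :=
    have : Algebra.EssFiniteType A K := .of_isLocalization K A⁰
    .comp ℝ A K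
  by_cases hΩ : Subsingleton (Ω[K⁄ℝ])
  · left
    have hu : Algebra.FormallyUnramified ℝ K := ⟨hΩ⟩
    have : Algebra.IsSeparable ℝ K := (Algebra.FormallyUnramified.iff_isSeparable ℝ K).1 hu
    intro j
    refine (isAlgebraic_algebraMap_iff hinj).1 ?_
    exact (Algebra.IsSeparable.isIntegral ℝ _).isAlgebraic
  · right
    rw [not_subsingleton_iff_nontrivial] at hΩ
    obtain ⟨ω, hω⟩ := exists_ne (0 : Ω[K⁄ℝ])
    obtain ⟨ℓ, hℓ⟩ : ∃ ℓ : Module.Dual K (Ω[K⁄ℝ]), ℓ ω ≠ 0 := by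
      by_contra! h
      exact hω ((Module.forall_dual_apply_eq_zero_iff K ω).1 h)
    set D₀ : Derivation ℝ K K := KaehlerDifferential.linearMapEquivDerivation ℝ K ℓ with hD₀
    have hD₀ne : D₀ ≠ 0 := fun h => by
      rw [hD₀, LinearEquiv.map_eq_zero_iff] at h
      exact hℓ (by simp [h])
    let ev : MvPolynomial ι ℝ →ₐ[ℝ] K := (IsScalarTower.toAlgHom ℝ A K).comp
      (Ideal.Quotient.mkₐ ℝ P)
    have hev : ∀ q, ev q = 0 ↔ q ∈ P := fun q => by
      change algebraMap A K (Ideal.Quotient.mk P q) = 0 ↔ _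
      rw [map_eq_zero_iff _ hinj, Ideal.Quotient.eq_zero_iff_mem]
    obtain ⟨b, hb⟩ := IsLocalization.exist_integer_multiples_of_finite A⁰
      (fun j => D₀ (ev (X j)))
    have hb0 : algebraMap A K (b : A) ≠ 0 := by
      rw [Ne, map_eq_zero_iff _ hinj]
      exact nonZeroDivisors.coe_ne_zero b
    choose c hc using hb
    choose a ha using fun j => Ideal.Quotient.mk_surjective (c j)
    let D : Derivation ℝ (MvPolynomial ι ℝ) (MvPolynomial ι ℝ) := mkDerivation ℝ a
    have hDX : ∀ j, ev (D (X j)) = algebraMap A K b * D₀ (ev (X j)) := fun j => by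
      have := hc j
      rw [Algebra.smul_def] at this
      rw [← this, ← ha j]
      simp only [D, mkDerivation_X]
      rfl
    have hD : ∀ q, ev (D q) = algebraMap A K b * D₀ (ev q) := fun q => by
      induction q using MvPolynomial.induction_on with
      | C r =>
        have h1 : D (C r) = 0 := D.map_algebraMap r
        have h2 : ev (C r) = algebraMap ℝ K r := ev.commutes r
        rw [h1, h2, D₀.map_algebraMap, map_zero, mul_zero]
      | add p q hp hq => simp only [map_add, hp, hq, mul_add]
      | mul_X p j hp =>
        simp only [Derivation.leibniz, map_add, map_mul, smul_eq_mul, hp, hDX]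
        ring
    refine ⟨D, fun q hq => ?_, ?_⟩
    · rw [← hev, hD, (hev q).2 hq, map_zero, mul_zero]
    · by_contra! hall
      have hX : ∀ j, D₀ (ev (X j)) = 0 := fun j => by
        have := (hev _).2 (hall j)
        rw [hDX] at this
        exact (mul_eq_zero.1 this).resolve_left hb0
      have hA : ∀ q, D₀ (ev q) = 0 := fun q => by
        induction q using MvPolynomial.induction_on with
        | C r =>
          have h2 : ev (C r) = algebraMap ℝ K r := ev.commutes r
          rw [h2, D₀.map_algebraMap]
        | add p q hp hq => simp only [map_add, hp, hq, add_zero]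
        | mul_X p j hp => simp only [Derivation.leibniz, map_mul, hp, hX, smul_zero, add_zero]
      refine hD₀ne (Derivation.ext fun x => ?_)
      obtain ⟨p, s, hs, rfl⟩ := IsFractionRing.div_surjective (A := A) x
      obtain ⟨p, rfl⟩ := Ideal.Quotient.mk_surjective p
      obtain ⟨s, rfl⟩ := Ideal.Quotient.mk_surjective s
      have hs0 : ev s ≠ 0 := fun h => nonZeroDivisors.ne_zero hs
        (Ideal.Quotient.eq_zero_iff_mem.2 ((hev s).1 h))
      change D₀ (ev p / ev s) = 0
      have h := hA p
      rw [← div_mul_cancel₀ (ev p) hs0, Derivation.leibniz, hA s, smul_zero, zero_add,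
        smul_eq_mul] at h
      exact (mul_eq_zero.1 h).resolve_left hs0

theorem MvPolynomial.finite_zeroLocus_of_isAlgebraic {ι : Type} [Finite ι]
    {P : Ideal (MvPolynomial ι ℝ)} (h : ∀ j, IsAlgebraic ℝ (Ideal.Quotient.mk P (X j))) :
    (zeroLocus ℝ P).Finite := by
  choose p hp0 hp using h
  refine (Set.Finite.pi' fun j => (p j).rootSet_finite ℝ).subset fun x hx j => ?_
  rw [Polynomial.mem_rootSet]
  refine ⟨hp0 j, ?_⟩
  have hm : Polynomial.aeval (X j : MvPolynomial ι ℝ) (p j) ∈ P := by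
    rw [← Ideal.Quotient.eq_zero_iff_mem, ← hp j]
    exact (Polynomial.aeval_algHom_apply (Ideal.Quotient.mkₐ ℝ P) (X j) (p j)).symm
  have := hx _ hm
  rwa [← Polynomial.aeval_algHom_apply, aeval_X] at this

namespace MvPolynomial
theorem hasDerivAt_aeval_comp {ι : Type*} (D : Derivation ℝ (MvPolynomial ι ℝ) (MvPolynomial ι ℝ))
    {α : ℝ → ι → ℝ} {t : ℝ}
    (hα : HasDerivAt α (fun j => aeval (α t) (D (X j))) t) (q : MvPolynomial ι ℝ) :
    HasDerivAt (fun s => aeval (α s) q) (aeval (α t) (D q)) t := by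
  induction q using MvPolynomial.induction_on with
  | C r =>
    have h1 : D (C r) = 0 := D.map_algebraMap r
    simpa [h1] using hasDerivAt_const t r
  | add p q hp hq =>
    simp only [map_add]
    exact hp.add hq
  | mul_X p j hp =>
    have := hp.mul (hasDerivAt_pi.1 hα j)
    simp only [Derivation.leibniz, map_add, map_mul, smul_eq_mul, aeval_X]
    exact this.congr_deriv (by ring)

theorem continuous_aeval_real {ι : Type*} (q : MvPolynomial ι ℝ) :
    Continuous fun x : ι → ℝ => aeval x q := by
  simpa using MvPolynomial.continuous_eval q

/-- The zero locus of an ideal is preserved by the flow of a derivation preserving the ideal. -/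
theorem exists_integralCurve_zeroLocus {ι : Type*} [Fintype ι] {J : Ideal (MvPolynomial ι ℝ)}
    (D : Derivation ℝ (MvPolynomial ι ℝ) (MvPolynomial ι ℝ)) (hD : ∀ q ∈ J, D q ∈ J)
    {x : ι → ℝ} (hx : x ∈ zeroLocus ℝ J) :
    ∃ α : ℝ → ι → ℝ, ∃ δ > 0, α 0 = x ∧ (∀ t ∈ Icc 0 δ, α t ∈ zeroLocus ℝ J) ∧
      ∀ t ∈ Icc 0 δ, HasDerivAt α (fun j => aeval (α t) (D (X j))) t := by
  have hF : ContDiffAt ℝ 1 (fun y : ι → ℝ => fun j => aeval y (D (X j))) x :=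
    contDiffAt_pi.2 fun j => (AnalyticAt.aeval_mvPolynomial
      (fun i => (ContinuousLinearMap.proj (R := ℝ) (φ := fun _ : ι => ℝ) i).analyticAt x)
      (D (X j))).contDiffAt
  obtain ⟨α, hα0, ε, hε, hα⟩ :=
    hF.exists_forall_mem_closedBall_exists_eq_forall_mem_Ioo_hasDerivAt₀ 0
  have hα' : ∀ t ∈ Icc 0 (ε / 2), HasDerivAt α (fun j => aeval (α t) (D (X j))) t :=
    fun t ht => hα t ⟨by linarith [ht.1], by linarith [ht.2]⟩
  refine ⟨α, ε / 2, by positivity, hα0, ?_, hα'⟩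
  obtain ⟨k, v, hv⟩ := Submodule.fg_iff_exists_fin_generating_family.1
    (IsNoetherian.noetherian J)
  have hvJ : ∀ l, v l ∈ J := fun l => hv ▸ Submodule.subset_span (mem_range_self l)
  have hc : ∀ l, ∃ c : Fin k → MvPolynomial ι ℝ, ∑ l', c l' * v l' = D (v l) := fun l => by
    have := hD _ (hvJ l)
    rw [← hv] at this
    exact (Submodule.mem_span_range_iff_exists_fun _).1 this
  choose c hc using hc
  have hαc : ContinuousOn α (Icc 0 (ε / 2)) := fun t ht => (hα' t ht).continuousAt.continuousWithinAt
  have hbd : ∀ l l', ∃ M, ∀ t ∈ Icc 0 (ε / 2), ‖aeval (α t) (c l l')‖ ≤ M := fun l l' =>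
    isCompact_Icc.exists_bound_of_continuousOn
      ((continuous_aeval_real (c l l')).comp_continuousOn hαc)
  choose M hM using hbd
  have hzero := eq_zero_of_abs_deriv_le_mul_abs_self_of_eq_zero_right
    (f := fun t l => aeval (α t) (v l)) (f' := fun t l => aeval (α t) (D (v l)))
    (K := ∑ l, ∑ l', |M l l'|) (a := 0) (b := ε / 2)
    (continuousOn_pi.2 fun l => (continuous_aeval_real (v l)).comp_continuousOn hαc)
    (fun t ht => (hasDerivAt_pi.2 fun l =>
      hasDerivAt_aeval_comp D (hα' t (Ico_subset_Icc_self ht)) (v l)).hasDerivWithinAt)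
    (by
      funext l
      change aeval (α 0) (v l) = 0
      rw [hα0]
      exact hx _ (hvJ l))
    (fun t ht => by
      refine (pi_norm_le_iff_of_nonneg (by positivity)).2 fun l => ?_
      rw [← hc l, map_sum]
      refine (norm_sum_le _ _).trans ?_
      calc _ ≤ ∑ l', |M l l'| * ‖fun l => aeval (α t) (v l)‖ := by
            refine Finset.sum_le_sum fun l' _ => ?_
            rw [map_mul, norm_mul]
            gcongr
            · exact (hM l l' t (Ico_subset_Icc_self ht)).trans (le_abs_self _)
            · exact norm_le_pi_norm (fun l => aeval (α t) (v l)) l'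
        _ = (∑ l', |M l l'|) * ‖fun l => aeval (α t) (v l)‖ := by rw [Finset.sum_mul]
        _ ≤ _ := by
            refine mul_le_mul_of_nonneg_right ?_ (norm_nonneg _)
            exact Finset.single_le_sum (f := fun l => ∑ l', |M l l'|)
              (fun _ _ => by positivity) (Finset.mem_univ l))
  intro t ht q hq
  rw [← hv] at hq
  obtain ⟨d, rfl⟩ := (Submodule.mem_span_range_iff_exists_fun _).1 hq
  rw [map_sum]
  refine Finset.sum_eq_zero fun l _ => ?_
  rw [smul_eq_mul, map_mul]
  have : aeval (α t) (v l) = 0 := congrFun (hzero t ht) l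
  rw [this, mul_zero]

end MvPolynomial

namespace MvPolynomial

theorem isClosed_zeroLocus {ι : Type*} (J : Ideal (MvPolynomial ι ℝ)) :
    IsClosed (zeroLocus ℝ J) := by
  have : zeroLocus ℝ J = ⋂ q ∈ J, {x | aeval x q = 0} := by ext; simp
  rw [this]
  exact isClosed_biInter fun q _ => isClosed_eq (continuous_aeval_real q) continuous_const

theorem aeval_eq_zero_of_isMinOn {ι : Type*} [Fintype ι] {J : Ideal (MvPolynomial ι ℝ)}
    (D : Derivation ℝ (MvPolynomial ι ℝ) (MvPolynomial ι ℝ)) (hD : ∀ q ∈ J, D q ∈ J)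
    (q : MvPolynomial ι ℝ) {x : ι → ℝ} (hx : x ∈ zeroLocus ℝ J)
    (hmin : IsMinOn (fun y : ι → ℝ => aeval y q)
      (connectedComponentIn (zeroLocus ℝ J) x) x) :
    aeval x (D q) = 0 := by
  have key : ∀ D : Derivation ℝ (MvPolynomial ι ℝ) (MvPolynomial ι ℝ), (∀ q ∈ J, D q ∈ J) →
      0 ≤ aeval x (D q) := by
    intro D hD
    obtain ⟨α, δ, hδ, hα0, hαJ, hα⟩ := exists_integralCurve_zeroLocus D hD hx
    have hd := hasDerivAt_aeval_comp D (hα 0 ⟨le_rfl, hδ.le⟩) q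
    have hsub : α '' Icc 0 δ ⊆ connectedComponentIn (zeroLocus ℝ J) x := by
      refine (isPreconnected_Icc.image α fun t ht =>
        (hα t ht).continuousAt.continuousWithinAt).subset_connectedComponentIn
        ⟨0, ⟨le_rfl, hδ.le⟩, hα0⟩ ?_
      rintro _ ⟨t, ht, rfl⟩
      exact hαJ t ht
    rw [hα0] at hd
    have hs := (hasDerivWithinAt_iff_tendsto_slope' self_notMem_Ioi).1
      (hd.hasDerivWithinAt (s := Ioi 0))
    refine ge_of_tendsto hs ?_
    have h1 : ∀ᶠ t in 𝓝[>] (0 : ℝ), t < δ :=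
      nhdsWithin_le_nhds (Iio_mem_nhds hδ)
    filter_upwards [h1, self_mem_nhdsWithin] with t ht ht0
    have ht0 : 0 < t := ht0
    rw [slope_def_field, hα0]
    refine div_nonneg (sub_nonneg.2 (hmin (hsub ⟨t, ⟨ht0.le, ht.le⟩, rfl⟩))) (by linarith)
  refine le_antisymm ?_ (key D hD)
  have := key (-D) fun q hq => by simpa using hD q hq
  simpa using this

/-- A compact real algebraic set is a finite union of connected sets. -/
theorem isFiniteUnionPreconnected_zeroLocus {ι : Type} [Fintype ι]
    (J : Ideal (MvPolynomial ι ℝ)) (hc : IsCompact (zeroLocus ℝ J)) :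
    IsFiniteUnionPreconnected (zeroLocus ℝ J) := by
  induction J using WellFoundedGT.induction with
  | ind J ih =>
    have ih' : ∀ J' > J, IsFiniteUnionPreconnected (zeroLocus ℝ J') := fun J' hJ' =>
      ih J' hJ' (hc.of_isClosed_subset (isClosed_zeroLocus J') (zeroLocus_anti_mono hJ'.le))
    by_cases hrad : vanishingIdeal ℝ (zeroLocus ℝ J) ≤ J
    swap
    · have hlt : J < vanishingIdeal ℝ (zeroLocus ℝ J) :=
        lt_of_le_not_ge (le_vanishingIdeal_zeroLocus J) hrad
      have heq : zeroLocus ℝ (vanishingIdeal ℝ (zeroLocus ℝ J)) = zeroLocus ℝ J :=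
        Subset.antisymm (zeroLocus_anti_mono (le_vanishingIdeal_zeroLocus J))
          (zeroLocus_vanishingIdeal_le _)
      rw [← heq]
      exact ih' _ hlt
    by_cases hprime : J.IsPrime
    swap
    · rw [Ideal.isPrime_iff] at hprime
      push Not at hprime
      by_cases htop : J = ⊤
      · rw [htop, zeroLocus_top]
        exact Set.finite_empty.isFiniteUnionPreconnected
      obtain ⟨a, b, hab, ha, hb⟩ := hprime htop
      have hlt : ∀ a ∉ J, J < J ⊔ Ideal.span {a} := fun a ha =>
        left_lt_sup.2 fun h => ha (h (Ideal.mem_span_singleton_self a))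
      have : zeroLocus ℝ J =
          zeroLocus ℝ (J ⊔ Ideal.span {a}) ∪ zeroLocus ℝ (J ⊔ Ideal.span {b}) := by
        refine Subset.antisymm (fun x hx => ?_) (union_subset
          (zeroLocus_anti_mono le_sup_left) (zeroLocus_anti_mono le_sup_left))
        have h0 := hx _ hab
        rw [map_mul, mul_eq_zero] at h0
        refine h0.imp (fun h => ?_) fun h => ?_
        all_goals
          rw [← singleton_subset_iff]
          refine le_zeroLocus_iff_le_vanishingIdeal.2 (sup_le ?_ ?_)
          · exact le_zeroLocus_iff_le_vanishingIdeal.1 (singleton_subset_iff.2 hx)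
          · rw [Ideal.span_singleton_le_iff_mem]
            simpa using h
      rw [this]
      exact (ih' _ (hlt a ha)).union (ih' _ (hlt b hb))
    rcases isAlgebraic_or_exists_derivation J with halg | ⟨D, hD, j, hj⟩
    · exact (finite_zeroLocus_of_isAlgebraic halg).isFiniteUnionPreconnected
    have hlt : J < J ⊔ Ideal.span {D (X j)} :=
      left_lt_sup.2 fun h => hj (h (Ideal.mem_span_singleton_self _))
    refine (ih' _ hlt).of_subset (zeroLocus_anti_mono le_sup_left) fun x hx => ?_
    have hCc : IsCompact (connectedComponentIn (zeroLocus ℝ J) x) := by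
      refine hc.of_isClosed_subset ?_ (connectedComponentIn_subset _ _)
      refine closure_subset_iff_isClosed.1 ?_
      exact isPreconnected_connectedComponentIn.closure.subset_connectedComponentIn
        (subset_closure (mem_connectedComponentIn hx))
        (closure_minimal (connectedComponentIn_subset _ _) (isClosed_zeroLocus J))
    obtain ⟨y, hy, hymin⟩ := hCc.exists_isMinOn ⟨x, mem_connectedComponentIn hx⟩
      (continuous_aeval_real (X j)).continuousOn
    have hyJ := connectedComponentIn_subset _ _ hy
    rw [connectedComponentIn_eq hy] at hymin
    have h0 := aeval_eq_zero_of_isMinOn D hD (X j) hyJ hymin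
    refine ⟨y, hy, ?_⟩
    rw [← singleton_subset_iff]
    refine le_zeroLocus_iff_le_vanishingIdeal.2 (sup_le ?_ ?_)
    · exact le_zeroLocus_iff_le_vanishingIdeal.1 (singleton_subset_iff.2 hyJ)
    · rw [Ideal.span_singleton_le_iff_mem]
      simpa using h0

end MvPolynomial

theorem isFiniteUnionPreconnected_zeros_inter_closedBall {m : ℕ} (T : Set (MvPolynomial (Fin m) ℝ))
    (x : EuclideanSpace ℝ (Fin m)) {ρ : ℝ} (hρ : 0 ≤ ρ) :
    IsFiniteUnionPreconnected
      ({y : EuclideanSpace ℝ (Fin m) | ∀ p ∈ T, MvPolynomial.eval (fun k => y k) p = 0} ∩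
        closedBall x ρ) := by
  let q : MvPolynomial (Option (Fin m)) ℝ :=
    ∑ k, (MvPolynomial.X (some k) - MvPolynomial.C (x k)) ^ 2 + MvPolynomial.X none ^ 2 -
      MvPolynomial.C (ρ ^ 2)
  let J : Ideal (MvPolynomial (Option (Fin m)) ℝ) :=
    Ideal.span (MvPolynomial.rename some '' T ∪ {q})
  have hJ : ∀ u : Option (Fin m) → ℝ, u ∈ MvPolynomial.zeroLocus ℝ J ↔
      (∀ p ∈ T, MvPolynomial.eval (fun k => u (some k)) p = 0) ∧
        ∑ k, (u (some k) - x k) ^ 2 + u none ^ 2 = ρ ^ 2 := by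
    intro u
    have hq : MvPolynomial.aeval u q = ∑ k, (u (some k) - x k) ^ 2 + u none ^ 2 - ρ ^ 2 := by
      simp [q]
    rw [MvPolynomial.zeroLocus_span, mem_ofPred_eq]
    simp only [mem_union, mem_singleton_iff, or_imp, forall_and, forall_eq, hq, sub_eq_zero,
      forall_mem_image, MvPolynomial.aeval_rename]
    rfl
  have hc : IsCompact (MvPolynomial.zeroLocus ℝ J) := by
    refine (isCompact_univ_pi (s := fun o : Option (Fin m) =>
      o.elim (Icc (-ρ) ρ) fun k => Icc (x k - ρ) (x k + ρ)) ?_).of_isClosed_subset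
      (MvPolynomial.isClosed_zeroLocus J) fun u hu => ?_
    · rintro (_ | k)
      exacts [isCompact_Icc, isCompact_Icc]
    · obtain ⟨-, hu⟩ := (hJ u).1 hu
      have hs : ∀ k, (u (some k) - x k) ^ 2 ≤ ∑ k, (u (some k) - x k) ^ 2 := fun k =>
        Finset.single_le_sum (f := fun k => (u (some k) - x k) ^ 2)
          (fun _ _ => sq_nonneg _) (Finset.mem_univ k)
      have hs0 : 0 ≤ ∑ k, (u (some k) - x k) ^ 2 := Finset.sum_nonneg fun _ _ => sq_nonneg _
      rintro (_ | k) -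
      · exact abs_le.1 (abs_le_of_sq_le_sq (by linarith) hρ)
      · have := abs_le.1 (abs_le_of_sq_le_sq
          (show (u (some k) - x k) ^ 2 ≤ ρ ^ 2 by nlinarith [hs k, sq_nonneg (u none)]) hρ)
        exact ⟨by linarith [this.1], by linarith [this.2]⟩
  have hφ : Continuous fun u : Option (Fin m) → ℝ =>
      (WithLp.toLp 2 fun k => u (some k) : EuclideanSpace ℝ (Fin m)) := by fun_prop
  convert (MvPolynomial.isFiniteUnionPreconnected_zeroLocus J hc).image hφ using 1
  ext y
  have hy : y ∈ closedBall x ρ ↔ ∑ k, (y k - x k) ^ 2 ≤ ρ ^ 2 := by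
    rw [mem_closedBall, EuclideanSpace.dist_eq, Real.sqrt_le_left hρ]
    simp [Real.dist_eq]
  constructor
  · rintro ⟨hyT, hyb⟩
    refine ⟨fun o => o.elim (√(ρ ^ 2 - ∑ k, (y k - x k) ^ 2)) fun k => y k,
      (hJ _).2 ⟨hyT, ?_⟩, rfl⟩
    simp only [Option.elim]
    rw [Real.sq_sqrt (sub_nonneg.2 (hy.1 hyb))]
    ring
  · rintro ⟨u, hu, rfl⟩
    obtain ⟨huT, hu⟩ := (hJ u).1 hu
    refine ⟨huT, hy.2 ?_⟩
    dsimp only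
    linarith [sq_nonneg (u none)]

/-- Two points in the same connected component of a real algebraic set are joined by a path. -/
theorem joinedIn_zeros_of_mem_connectedComponentIn {m : ℕ} (T : Set (MvPolynomial (Fin m) ℝ))
    {x y : EuclideanSpace ℝ (Fin m)}
    (hx : x ∈ {y : EuclideanSpace ℝ (Fin m) | ∀ p ∈ T, MvPolynomial.eval (fun k => y k) p = 0})
    (hy : y ∈ connectedComponentIn
      {y : EuclideanSpace ℝ (Fin m) | ∀ p ∈ T, MvPolynomial.eval (fun k => y k) p = 0} x) :
    JoinedIn {y : EuclideanSpace ℝ (Fin m) | ∀ p ∈ T, MvPolynomial.eval (fun k => y k) p = 0}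
      x y := by
  set Z := {y : EuclideanSpace ℝ (Fin m) | ∀ p ∈ T, MvPolynomial.eval (fun k => y k) p = 0}
  have hZ : IsClosed Z := by
    have : Z = ⋂ p ∈ T, {y | MvPolynomial.eval (fun k => y k) p = 0} := by ext; simp [Z]
    rw [this]
    refine isClosed_biInter fun p _ => isClosed_eq ?_ continuous_const
    exact (MvPolynomial.continuous_eval p).comp (by fun_prop)
  refine IsPreconnected.joinedIn_of_hasSmallPreconnectedNhds hZ (fun w hw ε hε => ?_)
    isPreconnected_connectedComponentIn (connectedComponentIn_subset _ _)
    (mem_connectedComponentIn hx) hy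
  have hmem : w ∈ Z ∩ closedBall w ε := ⟨hw, mem_closedBall_self hε.le⟩
  have hsub := connectedComponentIn_subset (Z ∩ closedBall w ε) w
  refine ⟨_, hsub.trans inter_subset_left, isPreconnected_connectedComponentIn,
    mem_connectedComponentIn hmem, hsub.trans inter_subset_right, ?_⟩
  have := (isFiniteUnionPreconnected_zeros_inter_closedBall T w
    hε.le).connectedComponentIn_mem_nhdsWithin (hZ.inter isClosed_closedBall) w
  rwa [nhdsWithin_inter_of_mem' (nhdsWithin_le_nhds (closedBall_mem_nhds w hε))] at this

theorem IsPolyMap.joinedIn_fiber {m n : ℕ}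
    {f : EuclideanSpace ℝ (Fin m) → EuclideanSpace ℝ (Fin n)} (hf : IsPolyMap f)
    {t : EuclideanSpace ℝ (Fin n)} {x y : EuclideanSpace ℝ (Fin m)} (hx : x ∈ f ⁻¹' {t})
    (hy : y ∈ connectedComponentIn (f ⁻¹' {t}) x) : JoinedIn (f ⁻¹' {t}) x y := by
  choose P hP using hf
  have hZ : f ⁻¹' {t} = {y | ∀ p ∈ range fun j => P j - MvPolynomial.C (t j),
      MvPolynomial.eval (fun k => y k) p = 0} := by
    ext y
    simp [← hP, sub_eq_zero, PiLp.ext_iff]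
  rw [hZ] at hx hy ⊢
  exact joinedIn_zeros_of_mem_connectedComponentIn _ hx hy

/-! ### Homotopies inside a subset -/

section
variable {Z E : Type*} [TopologicalSpace Z] [TopologicalSpace E] {A : Set E} {h₀ h₁ h₂ : Z → E}

theorem HomotopicIn.symm (h : HomotopicIn h₀ h₁ A) : HomotopicIn h₁ h₀ A := by
  obtain ⟨H, hc, hA, h0, h1⟩ := h
  refine ⟨fun q => H (q.1, unitInterval.symm q.2), by fun_prop, fun q => hA _, fun z => ?_,
    fun z => ?_⟩
  · simp [h1]
  · simp [h0]

theorem HomotopicIn.trans (h : HomotopicIn h₀ h₁ A) (h' : HomotopicIn h₁ h₂ A) :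
    HomotopicIn h₀ h₂ A := by
  obtain ⟨H, hc, hA, h0, h1⟩ := h
  obtain ⟨K, kc, kA, k0, k1⟩ := h'
  let F : ContinuousMap.Homotopy (⟨fun z => ⟨H (z, 0), hA _⟩, by fun_prop⟩ : C(Z, A))
      ⟨fun z => ⟨K (z, 0), kA _⟩, by fun_prop⟩ :=
    { toFun := fun q => ⟨H (q.2, q.1), hA _⟩
      continuous_toFun := by fun_prop
      map_zero_left := fun z => rfl
      map_one_left := fun z => Subtype.ext ((h1 z).trans (k0 z).symm) }
  let G : ContinuousMap.Homotopy (⟨fun z => ⟨K (z, 0), kA _⟩, by fun_prop⟩ : C(Z, A))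
      ⟨fun z => ⟨K (z, 1), kA _⟩, by fun_prop⟩ :=
    { toFun := fun q => ⟨K (q.2, q.1), kA _⟩
      continuous_toFun := by fun_prop
      map_zero_left := fun z => rfl
      map_one_left := fun z => rfl }
  refine ⟨fun q => (F.trans G (q.2, q.1)).1, by fun_prop, fun q => (F.trans G (q.2, q.1)).2,
    fun z => ?_, fun z => ?_⟩
  · dsimp only
    rw [ContinuousMap.Homotopy.apply_zero, ← h0]
    rfl
  · dsimp only
    rw [ContinuousMap.Homotopy.apply_one, ← k1]
    rfl

theorem HomotopicIn.nullHomotopicIn (h : HomotopicIn h₀ h₁ A) (h' : NullHomotopicIn h₁ A) :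
    NullHomotopicIn h₀ A := by
  obtain ⟨K, c, hK⟩ := h'
  obtain ⟨H, hH⟩ := h.trans (h₂ := fun _ => c) ⟨K, hK⟩
  exact ⟨H, c, hH⟩

theorem NullHomotopicIn.mono {A' : Set E} (h : NullHomotopicIn h₀ A) (hA : A ⊆ A') :
    NullHomotopicIn h₀ A' := by
  obtain ⟨H, c, hc, hm, h0, h1⟩ := h
  exact ⟨H, c, hc, fun q => hA (hm q), h0, h1⟩

theorem NullHomotopicIn.comp {Y : Type*} [TopologicalSpace Y] (h : NullHomotopicIn h₀ A)
    {φ : Y → Z} (hφ : Continuous φ) : NullHomotopicIn (h₀ ∘ φ) A := by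
  obtain ⟨H, c, hc, hm, h0, h1⟩ := h
  exact ⟨fun q => H (φ q.1, q.2), c, by fun_prop, fun q => hm _, fun z => h0 _, fun z => h1 _⟩

end

/-! ### Radial projection to the sphere -/

/-- The last unit vector, as a point of the sphere. -/
def sphereNorth (i : ℕ) : ↥(SphS i) := ⟨EuclideanSpace.single (Fin.last i) 1, by simp [SphS]⟩

open Classical in
/-- Radial projection to the sphere, with an arbitrary value at the origin. -/
def sphereProj (i : ℕ) (v : EuclideanSpace ℝ (Fin (i + 1))) : ↥(SphS i) :=
  if h : v = 0 then sphereNorth i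
  else ⟨‖v‖⁻¹ • v, by simp [SphS, norm_smul, inv_mul_cancel₀ (norm_ne_zero_iff.2 h)]⟩

section
variable {i : ℕ}

theorem coe_sphereProj {v : EuclideanSpace ℝ (Fin (i + 1))} (hv : v ≠ 0) :
    (sphereProj i v : EuclideanSpace ℝ (Fin (i + 1))) = ‖v‖⁻¹ • v := by
  simp [sphereProj, hv]

theorem SphS.ne_zero (z : ↥(SphS i)) : (z : EuclideanSpace ℝ (Fin (i + 1))) ≠ 0 :=
  ne_zero_of_mem_unit_sphere z

theorem SphS.norm_eq (z : ↥(SphS i)) : ‖(z : EuclideanSpace ℝ (Fin (i + 1)))‖ = 1 :=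
  norm_eq_of_mem_sphere z

theorem sphereProj_coe (z : ↥(SphS i)) : sphereProj i z = z :=
  Subtype.ext (by rw [coe_sphereProj (SphS.ne_zero z), SphS.norm_eq, inv_one, one_smul])

theorem sphereProj_smul_north {r : ℝ} (hr : 0 < r) :
    sphereProj i (r • (sphereNorth i : EuclideanSpace ℝ (Fin (i + 1)))) = sphereNorth i := by
  refine Subtype.ext ?_
  rw [coe_sphereProj (smul_ne_zero hr.ne' (SphS.ne_zero _)), norm_smul, SphS.norm_eq, mul_one,
    Real.norm_of_nonneg hr.le, inv_smul_smul₀ hr.ne']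

theorem continuousOn_sphereProj : ContinuousOn (sphereProj i) {0}ᶜ := by
  rw [IsInducing.subtypeVal.continuousOn_iff]
  refine ContinuousOn.congr (f := fun v => ‖v‖⁻¹ • v) ?_ fun v hv => coe_sphereProj hv
  exact (continuousOn_id.norm.inv₀ fun v hv => norm_ne_zero_iff.2 hv).smul continuousOn_id

theorem Continuous.sphereProj {Z : Type*} [TopologicalSpace Z]
    {M : Z → EuclideanSpace ℝ (Fin (i + 1))} (hM : Continuous M) (h0 : ∀ z, M z ≠ 0) :
    Continuous fun z => sphereProj i (M z) :=
  continuousOn_sphereProj.comp_continuous hM h0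

variable {E : Type*} [TopologicalSpace E] {A B : Set E} {G : ↥(SphS i) → E}

theorem exists_extension_of_nullHomotopicIn (hG : NullHomotopicIn G A) :
    ∃ F : EuclideanSpace ℝ (Fin (i + 1)) → E, Continuous F ∧ (∀ v, F v ∈ A) ∧
      ∀ v, 1 ≤ ‖v‖ → F v = G (sphereProj i v) := by
  obtain ⟨H, c, hc, hA, h0, h1⟩ := hG
  refine ⟨fun v => H (sphereProj i v, projIcc 0 1 zero_le_one (1 - ‖v‖)), ?_, fun v => hA _,
    fun v hv => ?_⟩
  · refine continuous_iff_continuousAt.2 fun v => ?_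
    by_cases hv : v = 0
    · subst hv
      rw [ContinuousAt, show H (sphereProj i 0, projIcc 0 1 zero_le_one
        (1 - ‖(0 : EuclideanSpace ℝ (Fin (i + 1)))‖)) = c by
          rw [norm_zero, sub_zero, projIcc_right]; exact h1 _]
      intro U hU
      have hcpt : CompactSpace ↥(SphS i) :=
        isCompact_iff_compactSpace.1 (isCompact_sphere (0 : EuclideanSpace ℝ (Fin (i + 1))) 1)
      have hev : ∀ᶠ τ in 𝓝 (1 : I), ∀ z ∈ (univ : Set ↥(SphS i)), H (z, τ) ∈ U := by
        refine isCompact_univ.eventually_forall_of_forall_eventually fun z _ => ?_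
        have : Tendsto (fun q : I × ↥(SphS i) => H (q.2, q.1)) (𝓝 (1, z)) (𝓝 c) := by
          rw [← h1 z]
          exact (show Continuous fun q : I × ↥(SphS i) => H (q.2, q.1) by fun_prop).tendsto _
        exact this hU
      have ht : Tendsto (fun v : EuclideanSpace ℝ (Fin (i + 1)) =>
          (projIcc 0 1 zero_le_one (1 - ‖v‖) : I)) (𝓝 0) (𝓝 1) := by
        have hcont : Continuous fun v : EuclideanSpace ℝ (Fin (i + 1)) =>
          (projIcc 0 1 zero_le_one (1 - ‖v‖) : I) := continuous_projIcc.comp (by fun_prop)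
        convert hcont.tendsto 0
        rw [norm_zero, sub_zero, projIcc_right]
        rfl
      rw [mem_map]
      filter_upwards [ht.eventually hev] with v hv using hv _ (mem_univ _)
    · refine hc.continuousAt.comp (ContinuousAt.prodMk ?_ ?_)
      · exact continuousOn_sphereProj.continuousAt (isOpen_compl_singleton.mem_nhds hv)
      · exact (continuous_projIcc.comp (by fun_prop)).continuousAt
  · dsimp only
    rw [projIcc_of_le_left _ (by linarith)]
    exact h0 _

theorem homotopicIn_sphereProj (hG : Continuous G) (hGB : ∀ z, G z ∈ B) {Z : Type*}
    [TopologicalSpace Z] (M : Z × I → EuclideanSpace ℝ (Fin (i + 1))) (hM : Continuous M)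
    (h0 : ∀ q, M q ≠ 0) :
    HomotopicIn (fun z => G (sphereProj i (M (z, 0)))) (fun z => G (sphereProj i (M (z, 1)))) B :=
  ⟨fun q => G (sphereProj i (M q)), hG.comp (hM.sphereProj h0), fun _ => hGB _, fun _ => rfl,
    fun _ => rfl⟩

end

/-! ### Moving the base point -/

section
variable {i : ℕ} {E : Type*} [TopologicalSpace E] {B : Set E} {G : ↥(SphS i) → E}

theorem sphereNorth_apply_last :
    (sphereNorth i : EuclideanSpace ℝ (Fin (i + 1))) (Fin.last i) = 1 := by
  simp [sphereNorth]

theorem HomotopicIn.exists_apply_north_eq (hG : Continuous G) (hGB : ∀ z, G z ∈ B) {x : E}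
    (hx : JoinedIn B (G (sphereNorth i)) x) :
    ∃ G' : ↥(SphS i) → E, Continuous G' ∧ HomotopicIn G G' B ∧ G' (sphereNorth i) = x := by
  let e : EuclideanSpace ℝ (Fin (i + 1)) := sphereNorth i
  let y : ↥(SphS i) → ℝ := fun z => (z : EuclideanSpace ℝ (Fin (i + 1))) (Fin.last i)
  let M : ↥(SphS i) × I → EuclideanSpace ℝ (Fin (i + 1)) := fun q =>
    ((1 - q.2) * max 0 (1 / 2 - y q.1) + q.2 : ℝ) • (q.1.1 - y q.1 • e) + y q.1 • e
  have hy : Continuous y := by fun_prop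
  have hM : Continuous M := by fun_prop
  have hM0 : ∀ q, M q ≠ 0 := by
    rintro ⟨z, τ⟩ h
    have hlast : y z = 0 := by
      have := congrArg (fun v => v (Fin.last i)) h
      simpa [M, e, sphereNorth_apply_last, y] using this
    simp only [M, hlast, zero_smul, sub_zero, add_zero, smul_eq_zero, SphS.ne_zero, or_false] at h
    have h0 := τ.2.1
    have h1 := τ.2.2
    norm_num at h
    linarith
  have hM1 : ∀ z, M (z, 1) = z := fun z => by simp [M]
  have hMN : ∀ z, 1 / 2 ≤ y z → sphereProj i (M (z, 0)) = sphereNorth i := fun z hz => by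
    have : M (z, 0) = y z • e := by
      simp only [M]
      rw [max_eq_left (by linarith)]
      simp
    rw [this]
    exact sphereProj_smul_north (by linarith)
  let ω := hx.somePath
  have hGM : HomotopicIn (fun z => G (sphereProj i (M (z, 0)))) G B := by
    have := homotopicIn_sphereProj hG hGB M hM hM0
    simpa only [hM1, sphereProj_coe] using this
  let K : ↥(SphS i) × I → E := fun q =>
    if y q.1 ≤ 1 / 2 then G (sphereProj i (M (q.1, 0))) else ω.extend (q.2 * (2 * y q.1 - 1))
  have hK : Continuous K := by
    refine Continuous.if_le (hG.comp (Continuous.sphereProj (by fun_prop) fun q => hM0 _))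
      (ω.continuous_extend.comp (by fun_prop)) (by fun_prop) (by fun_prop) fun q hq => ?_
    rw [hMN _ hq.ge, hq]
    simp
  have hK1 : HomotopicIn (fun z => G (sphereProj i (M (z, 0)))) (fun z => K (z, 1)) B := by
    refine ⟨K, hK, fun q => ?_, fun z => ?_, fun z => rfl⟩
    · dsimp only [K]
      split_ifs
      · exact hGB _
      · exact hx.somePath_mem _
    · dsimp only [K]
      split_ifs with h
      · rfl
      · rw [hMN _ (not_le.1 h).le]
        simp
  refine ⟨_, by fun_prop, hGM.symm.trans hK1, ?_⟩
  dsimp only [K]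
  rw [if_neg (by simp only [y, sphereNorth_apply_last]; norm_num)]
  simp only [y, sphereNorth_apply_last]
  norm_num

theorem SphS.exists_involution_north (z : ↥(SphS i)) :
    ∃ φ : ↥(SphS i) → ↥(SphS i), Continuous φ ∧ (∀ w, φ (φ w) = w) ∧ φ (sphereNorth i) = z := by
  let R := (ℝ ∙ ((sphereNorth i : EuclideanSpace ℝ (Fin (i + 1))) - z))ᗮ.reflection
  refine ⟨fun w => ⟨R w, by simp [SphS, SphS.norm_eq]⟩, by fun_prop, fun w => Subtype.ext ?_,
    Subtype.ext ?_⟩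
  · exact Submodule.reflection_reflection _ _
  · exact Submodule.reflection_sub (by rw [SphS.norm_eq, SphS.norm_eq])

end

/-! ### Comparing the sphere with the boundary of the cube -/

section
variable {i : ℕ}

/-- The distance of a point of the cube from the vertical axis through the centre, measured in
the sup norm and normalized to be `1` on the vertical faces. -/
def cubeRadius (p : Cube (i + 1)) : ℝ :=
  ‖fun j : Fin i => 2 * (p j.castSucc : ℝ) - 1‖

/-- A map from the cube to Euclidean space sending `JSet i` to twice the north pole and the
boundary of the cube to the complement of the open unit ball. -/
def cubeToEuclidean (i : ℕ) (p : Cube (i + 1)) : EuclideanSpace ℝ (Fin (i + 1)) :=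
  WithLp.toLp 2 fun j =>
    if j = Fin.last i then 2 * (2 * max (cubeRadius p) (p (Fin.last i)) - 1)
    else 8 * (1 - p (Fin.last i)) * (1 - cubeRadius p) * (2 * p j - 1)

theorem continuous_cubeRadius : Continuous (cubeRadius (i := i)) := by
  unfold cubeRadius
  fun_prop

theorem continuous_cubeToEuclidean : Continuous (cubeToEuclidean i) := by
  have := continuous_cubeRadius (i := i)
  refine (PiLp.continuous_toLp 2 _).comp (continuous_pi fun j => ?_)
  split_ifs <;> fun_prop

theorem cubeToEuclidean_last (p : Cube (i + 1)) : cubeToEuclidean i p (Fin.last i) =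
    2 * (2 * max (cubeRadius p) (p (Fin.last i)) - 1) := by
  simp [cubeToEuclidean]

theorem cubeToEuclidean_castSucc (p : Cube (i + 1)) (j : Fin i) :
    cubeToEuclidean i p j.castSucc =
      8 * (1 - p (Fin.last i)) * (1 - cubeRadius p) * (2 * p j.castSucc - 1) := by
  simp [cubeToEuclidean, (Fin.castSucc_lt_last j).ne]

theorem cubeRadius_nonneg (p : Cube (i + 1)) : 0 ≤ cubeRadius p := norm_nonneg _

theorem abs_le_cubeRadius (p : Cube (i + 1)) (j : Fin i) :
    |2 * (p j.castSucc : ℝ) - 1| ≤ cubeRadius p :=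
  norm_le_pi_norm (fun j : Fin i => 2 * (p j.castSucc : ℝ) - 1) j

theorem cubeRadius_le_one (p : Cube (i + 1)) : cubeRadius p ≤ 1 :=
  (pi_norm_le_iff_of_nonneg zero_le_one).2 fun j =>
    abs_le.2 ⟨by linarith [(p j.castSucc).2.1], by linarith [(p j.castSucc).2.2]⟩

theorem cubeRadius_eq_one {p : Cube (i + 1)} {j : Fin i}
    (hj : p j.castSucc = 0 ∨ p j.castSucc = 1) : cubeRadius p = 1 := by
  refine (cubeRadius_le_one p).antisymm ?_
  have := abs_le_cubeRadius p j
  rcases hj with hj | hj <;> rw [hj] at this <;> norm_num at this <;> exact this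

theorem cubeToEuclidean_of_mem_JSet {p : Cube (i + 1)} (hp : p ∈ JSet i) :
    cubeToEuclidean i p = (2 : ℝ) • (sphereNorth i : EuclideanSpace ℝ (Fin (i + 1))) := by
  obtain ⟨⟨j, hj⟩, hp⟩ := hp
  have key : cubeRadius p = 1 ∨ p (Fin.last i) = 1 := by
    by_cases h0 : p (Fin.last i) = 0
    · simp only [h0, true_and, not_forall, not_and_or, not_not] at hp
      obtain ⟨j, hj⟩ := hp
      exact Or.inl (cubeRadius_eq_one hj)
    · induction j using Fin.lastCases with
      | last => exact Or.inr (hj.resolve_left h0)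
      | cast j => exact Or.inl (cubeRadius_eq_one hj)
  have hmax : max (cubeRadius p) (p (Fin.last i) : ℝ) = 1 := by
    rcases key with h | h <;> rw [h]
    · exact max_eq_left (p _).2.2
    · exact max_eq_right (cubeRadius_le_one p)
  have hprod : (1 - (p (Fin.last i) : ℝ)) * (1 - cubeRadius p) = 0 := by
    rcases key with h | h <;> rw [h] <;> simp
  ext j
  induction j using Fin.lastCases with
  | last =>
    rw [cubeToEuclidean_last, hmax, PiLp.smul_apply, sphereNorth_apply_last]
    norm_num
  | cast j =>
    rw [cubeToEuclidean_castSucc, mul_assoc 8, hprod]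
    simp [sphereNorth, (Fin.castSucc_lt_last j).ne]

theorem one_le_norm_cubeToEuclidean_of_last_eq_zero {p : Cube (i + 1)} (hp : p (Fin.last i) = 0) :
    1 ≤ ‖cubeToEuclidean i p‖ := by
  by_contra! h
  have hcoord : ∀ j, |cubeToEuclidean i p j| < 1 := fun j =>
    (PiLp.norm_apply_le (cubeToEuclidean i p) j).trans_lt h
  have hl := hcoord (Fin.last i)
  rw [cubeToEuclidean_last, hp, abs_lt] at hl
  have hr : max (cubeRadius p) ((0 : I) : ℝ) = cubeRadius p := max_eq_left (cubeRadius_nonneg p)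
  rw [hr] at hl
  have hs : cubeRadius p ≤ (8 * (1 - cubeRadius p))⁻¹ := by
    refine (pi_norm_le_iff_of_nonneg (inv_nonneg.2 (by linarith))).2 fun j => ?_
    have := hcoord j.castSucc
    rw [cubeToEuclidean_castSucc, hp, abs_mul,
      abs_of_nonneg (by norm_num; linarith [cubeRadius_le_one p])] at this
    rw [Real.norm_eq_abs, ← one_div, le_div_iff₀ (by linarith)]
    norm_num at this
    linarith
  rw [← one_div, le_div_iff₀ (by linarith)] at hs
  nlinarith

theorem mem_JSet_of_last_ne_zero {p : Cube (i + 1)} (hp : ∃ j, p j = 0 ∨ p j = 1)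
    (h0 : p (Fin.last i) ≠ 0) : p ∈ JSet i :=
  ⟨hp, fun h => h0 h.1⟩

theorem one_le_norm_cubeToEuclidean {p : Cube (i + 1)} (hp : ∃ j, p j = 0 ∨ p j = 1) :
    1 ≤ ‖cubeToEuclidean i p‖ := by
  by_cases h0 : p (Fin.last i) = 0
  · exact one_le_norm_cubeToEuclidean_of_last_eq_zero h0
  · rw [cubeToEuclidean_of_mem_JSet (mem_JSet_of_last_ne_zero hp h0), norm_smul, SphS.norm_eq]
    norm_num

/-- A map from the sphere to the boundary of the cube, whose lower half goes to the bottom. -/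
def sphereToCube (i : ℕ) (z : ↥(SphS i)) : Cube (i + 1) := fun j =>
  projIcc 0 1 zero_le_one
    (if j = Fin.last i then (i + 1) * (z : EuclideanSpace ℝ (Fin (i + 1))) j
      else ((i + 1) * (z : EuclideanSpace ℝ (Fin (i + 1))) j + 1) / 2)

theorem continuous_sphereToCube : Continuous (sphereToCube i) := by
  refine continuous_pi fun j => continuous_projIcc.comp ?_
  split_ifs <;> fun_prop

theorem sphereToCube_last (z : ↥(SphS i)) : (sphereToCube i z (Fin.last i) : ℝ) =
    max 0 (min 1 ((i + 1) * (z : EuclideanSpace ℝ (Fin (i + 1))) (Fin.last i))) := by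
  simp [sphereToCube, coe_projIcc]

theorem sphereToCube_castSucc (z : ↥(SphS i)) (j : Fin i) :
    (sphereToCube i z j.castSucc : ℝ) =
      max 0 (min 1 (((i + 1) * (z : EuclideanSpace ℝ (Fin (i + 1))) j.castSucc + 1) / 2)) := by
  simp [sphereToCube, coe_projIcc, (Fin.castSucc_lt_last j).ne]

theorem SphS.exists_one_le_abs (z : ↥(SphS i)) :
    ∃ j, 1 ≤ |(i + 1) * (z : EuclideanSpace ℝ (Fin (i + 1))) j| := by
  by_contra! h
  have h1 : ∑ j, (z : EuclideanSpace ℝ (Fin (i + 1))) j ^ 2 = 1 := by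
    have := EuclideanSpace.norm_sq_eq (z : EuclideanSpace ℝ (Fin (i + 1)))
    rw [SphS.norm_eq] at this
    simpa using this.symm
  have h2 : ∑ j, ((i + 1 : ℝ) * (z : EuclideanSpace ℝ (Fin (i + 1))) j) ^ 2 < (i + 1 : ℝ) := by
    calc _ < ∑ j : Fin (i + 1), (1 : ℝ) :=
          Finset.sum_lt_sum_of_nonempty Finset.univ_nonempty fun j _ =>
            (sq_lt_one_iff_abs_lt_one _).2 (h j)
      _ = i + 1 := by simp
  simp only [mul_pow, ← Finset.mul_sum, h1] at h2
  nlinarith [(Nat.cast_nonneg i : (0 : ℝ) ≤ i)]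

theorem sphereToCube_mem_boundary (z : ↥(SphS i)) :
    ∃ j, sphereToCube i z j = 0 ∨ sphereToCube i z j = 1 := by
  obtain ⟨j, hj⟩ := SphS.exists_one_le_abs z
  refine ⟨j, ?_⟩
  unfold sphereToCube
  rcases le_abs'.1 hj with hj | hj
  · exact Or.inl (projIcc_of_le_left _ (by split_ifs <;> linarith))
  · exact Or.inr (projIcc_of_right_le _ (by split_ifs <;> linarith))

theorem segment_cubeToEuclidean_sphereToCube_ne_zero (z : ↥(SphS i)) (τ : I) :
    (1 - τ : ℝ) • cubeToEuclidean i (sphereToCube i z) +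
      (τ : ℝ) • (z : EuclideanSpace ℝ (Fin (i + 1))) ≠ 0 := by
  intro h
  set p := sphereToCube i z with hp
  have hcoord : ∀ j, (1 - τ : ℝ) * cubeToEuclidean i p j +
      τ * (z : EuclideanSpace ℝ (Fin (i + 1))) j = 0 := fun j => by
    simpa using congrArg (fun v => v j) h
  have h1 := τ.2.2
  rcases τ.2.1.eq_or_lt with h0 | h0
  · rw [← h0, sub_zero, one_smul, zero_smul, add_zero] at h
    have := one_le_norm_cubeToEuclidean (sphereToCube_mem_boundary z)
    rw [← hp, h, norm_zero] at this
    linarith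
  have hi : (0 : ℝ) < i + 1 := by positivity
  have hcast : ∀ j : Fin i, (z : EuclideanSpace ℝ (Fin (i + 1))) j.castSucc = 0 := fun j => by
    have hj := hcoord j.castSucc
    rw [cubeToEuclidean_castSucc] at hj
    have hsign : 0 ≤ (2 * (p j.castSucc : ℝ) - 1) *
        (z : EuclideanSpace ℝ (Fin (i + 1))) j.castSucc := by
      rw [hp, sphereToCube_castSucc]
      set a := (z : EuclideanSpace ℝ (Fin (i + 1))) j.castSucc
      rcases le_total 0 a with ha | ha
      · refine mul_nonneg ?_ ha
        have : 1 / 2 ≤ min 1 (((i + 1) * a + 1) / 2) :=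
          le_min (by norm_num) (by nlinarith [mul_nonneg hi.le ha])
        linarith [le_max_right 0 (min 1 (((i + 1) * a + 1) / 2))]
      · refine mul_nonneg_of_nonpos_of_nonpos ?_ ha
        have : max 0 (min 1 (((i + 1) * a + 1) / 2)) ≤ 1 / 2 :=
          max_le (by norm_num) ((min_le_right _ _).trans
            (by nlinarith [mul_nonpos_of_nonneg_of_nonpos hi.le ha]))
        linarith
    have hcoef : 0 ≤ (1 - τ : ℝ) * (8 * (1 - p (Fin.last i)) * (1 - cubeRadius p)) := by
      have := (p (Fin.last i)).2.2
      have := cubeRadius_le_one p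
      exact mul_nonneg (by linarith) (mul_nonneg (by linarith) (by linarith))
    have := mul_nonneg hcoef hsign
    have hsq : (τ : ℝ) * (z : EuclideanSpace ℝ (Fin (i + 1))) j.castSucc ^ 2 ≤ 0 := by
      linear_combination this + (z : EuclideanSpace ℝ (Fin (i + 1))) j.castSucc * hj
    exact pow_eq_zero_iff two_ne_zero |>.1
      (le_antisymm (nonpos_of_mul_nonpos_right hsq h0) (sq_nonneg _))
  have hrad : cubeRadius p = 0 := by
    refine norm_eq_zero.2 (funext fun j => ?_)
    rw [hp, sphereToCube_castSucc, hcast]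
    norm_num
  have hlast := hcoord (Fin.last i)
  rw [cubeToEuclidean_last, hrad, max_eq_right (p _).2.1, hp, sphereToCube_last] at hlast
  have habs : (z : EuclideanSpace ℝ (Fin (i + 1))) (Fin.last i) = 1 ∨
      (z : EuclideanSpace ℝ (Fin (i + 1))) (Fin.last i) = -1 := by
    have := EuclideanSpace.norm_sq_eq (z : EuclideanSpace ℝ (Fin (i + 1)))
    rw [SphS.norm_eq, Fin.sum_univ_castSucc] at this
    simp only [hcast] at this
    simpa using this.symm
  rcases habs with hz | hz <;> rw [hz] at hlast
  · rw [min_eq_left (by linarith), max_eq_right zero_le_one] at hlast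
    linarith
  · rw [max_eq_left ((min_le_right _ _).trans (by linarith))] at hlast
    linarith

end

/-! ### Spheres in `B` that are null-homotopic in `A` -/

section
variable {i : ℕ} {E : Type*} [TopologicalSpace E] {A B : Set E} {G : ↥(SphS i) → E} {x : E}

theorem HomotopicIn.mono {Z : Type*} [TopologicalSpace Z] {h₀ h₁ : Z → E}
    (h : HomotopicIn h₀ h₁ B) (hBA : B ⊆ A) : HomotopicIn h₀ h₁ A := by
  obtain ⟨H, hc, hm, h0, h1⟩ := h
  exact ⟨H, hc, fun q => hBA (hm q), h0, h1⟩

theorem isRelMap_comp_cubeToEuclidean {F : EuclideanSpace ℝ (Fin (i + 1)) → E}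
    (hF : Continuous F) (hFA : ∀ v, F v ∈ A) (hFG : ∀ v, 1 ≤ ‖v‖ → F v = G (sphereProj i v))
    (hGB : ∀ z, G z ∈ B) :
    IsRelMap i A B (G (sphereNorth i)) fun p => F (cubeToEuclidean i p) where
  continuous := hF.comp continuous_cubeToEuclidean
  mem_total _ := hFA _
  mem_base p hp := by
    rw [hFG _ (one_le_norm_cubeToEuclidean_of_last_eq_zero hp)]
    exact hGB _
  eq_base_pt p hp := by
    rw [hFG _ (one_le_norm_cubeToEuclidean hp.1), cubeToEuclidean_of_mem_JSet hp,
      sphereProj_smul_north two_pos]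

theorem RelHomotopic.homotopicIn_sphereToCube {h₀ h₁ : Cube (i + 1) → E}
    (h : RelHomotopic i A B x h₀ h₁) (hx : x ∈ B) :
    HomotopicIn (fun z => h₀ (sphereToCube i z)) (fun z => h₁ (sphereToCube i z)) B := by
  obtain ⟨H, hc, hrel, h0, h1⟩ := h
  refine ⟨fun q => H (sphereToCube i q.1, q.2),
    hc.comp ((continuous_sphereToCube.comp continuous_fst).prodMk continuous_snd),
    fun q => ?_, fun z => h0 _, fun z => h1 _⟩
  by_cases hz : sphereToCube i q.1 (Fin.last i) = 0
  · exact (hrel q.2).mem_base _ hz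
  · have := (hrel q.2).eq_base_pt _
      (mem_JSet_of_last_ne_zero (sphereToCube_mem_boundary q.1) hz)
    dsimp only at this ⊢
    rwa [this]

theorem nullHomotopicIn_comp_sphereToCube {h : Cube (i + 1) → E} (hc : Continuous h)
    (hB : ∀ p, h p ∈ B) : NullHomotopicIn (fun z => h (sphereToCube i z)) B := by
  refine ⟨fun q => h fun j => unitInterval.symm q.2 * sphereToCube i q.1 j, h fun _ => 0,
    hc.comp (continuous_pi fun j => ?_), fun q => hB _, fun z => ?_, fun z => ?_⟩
  · exact (unitInterval.continuous_symm.comp continuous_snd).mul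
      ((continuous_apply j).comp (continuous_sphereToCube.comp continuous_fst))
  · simp
  · simp

theorem RelPiTrivial.nullHomotopicIn_of_apply_north_eq (hπ : RelPiTrivial i A B x)
    (hG : Continuous G) (hGB : ∀ z, G z ∈ B) (hGx : G (sphereNorth i) = x)
    (hGA : NullHomotopicIn G A) : NullHomotopicIn G B := by
  obtain ⟨F, hF, hFA, hFG⟩ := exists_extension_of_nullHomotopicIn hGA
  have hrel := isRelMap_comp_cubeToEuclidean hF hFA hFG hGB
  rw [hGx] at hrel
  obtain ⟨h', hh', hB, hhom⟩ := hπ _ hrel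
  have hstep : HomotopicIn (fun z => F (cubeToEuclidean i (sphereToCube i z))) G B := by
    have := homotopicIn_sphereProj hG hGB (fun q : ↥(SphS i) × I =>
      (1 - q.2 : ℝ) • cubeToEuclidean i (sphereToCube i q.1) +
        (q.2 : ℝ) • (q.1 : EuclideanSpace ℝ (Fin (i + 1))))
      (((show Continuous fun q : ↥(SphS i) × I => (1 - q.2 : ℝ) by fun_prop).smul
        ((continuous_cubeToEuclidean.comp continuous_sphereToCube).comp continuous_fst)).add
        (by fun_prop))
      fun q => segment_cubeToEuclidean_sphereToCube_ne_zero q.1 q.2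
    convert this using 2 with z z
    · rw [hFG _ (one_le_norm_cubeToEuclidean (sphereToCube_mem_boundary z))]
      simp
    · simp [sphereProj_coe]
  exact hstep.symm.nullHomotopicIn ((hhom.homotopicIn_sphereToCube (hGx ▸ hGB _)).nullHomotopicIn
    (nullHomotopicIn_comp_sphereToCube hh'.continuous hB))

theorem RelPiTrivial.nullHomotopicIn (hπ : RelPiTrivial i A B x) (hBA : B ⊆ A)
    (hG : Continuous G) (hGB : ∀ z, G z ∈ B) {z : ↥(SphS i)} (hz : JoinedIn B (G z) x)
    (hGA : NullHomotopicIn G A) : NullHomotopicIn G B := by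
  obtain ⟨φ, hφ, hφφ, hφz⟩ := SphS.exists_involution_north z
  obtain ⟨G', hG', hGG', hG'x⟩ := HomotopicIn.exists_apply_north_eq (hG.comp hφ)
    (fun w => hGB _) (x := x) (by simpa [hφz] using hz)
  have hG'B : ∀ w, G' w ∈ B := fun w => by
    obtain ⟨H, -, hm, -, h1⟩ := hGG'
    exact h1 w ▸ hm _
  have := hGG'.nullHomotopicIn (hπ.nullHomotopicIn_of_apply_north_eq hG' hG'B hG'x
    ((hGG'.symm.mono hBA).nullHomotopicIn (hGA.comp hφ)))
  convert this.comp hφ using 1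
  funext w
  simp [hφφ]

end

theorem IsVanishingCycle.nullHomotopicIn_preimage_range {E B : Type*} [TopologicalSpace E]
    [TopologicalSpace B] {f : E → B} {γ : I → B} {i : ℕ} {g : ↥(SphS i) × I → E}
    (hg : IsVanishingCycle f γ i g) :
    NullHomotopicIn (fun z => g (z, 0)) (f ⁻¹' range γ) := by
  have h : HomotopicIn (fun z => g (z, 0)) (fun z => g (z, 1)) (f ⁻¹' range γ) :=
    ⟨g, hg.1, fun q => ⟨q.2, (hg.2.1 q.1 q.2).symm⟩, fun _ => rfl, fun _ => rfl⟩
  refine h.nullHomotopicIn ((hg.2.2 1 one_ne_zero).mono (preimage_mono ?_))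
  exact singleton_subset_iff.2 (mem_range_self 1)

/-- **Proposition 3.2 (Proposition 1).** Let `δ_{S'} = range γ` be an s-arc at `t0` on a
stratum `S' = S ∩ D ∈ 𝔖_{t0}`.  If `f : f⁻¹(δ_{S'}) → δ_{S'}` has a non-trivial
vanishing `i`-cycle `g`, then `π_{i+1}(f, δ_{S'}, x0) ≠ 1`, where `x0` is any point of
the connected component of `f⁻¹(t0)` meeting the image `g(S^i × {0})`. -/
theorem nontrivial_vanishing_cycle_implies_nontrivial_relative_homotopy
    (m n : ℕ) (hmn : n < m)
    (f : EuclideanSpace ℝ (Fin m) → EuclideanSpace ℝ (Fin n)) (hf : IsPolyMap f)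
    (𝔖 : Set (Set (EuclideanSpace ℝ (Fin n)))) (hfin : 𝔖.Finite)
    (hsemialg : ∀ S ∈ 𝔖, IsSemialgebraic S)
    (hpart : ∀ t : EuclideanSpace ℝ (Fin n), ∃! S, S ∈ 𝔖 ∧ t ∈ S)
    (hloctriv : ∀ S ∈ 𝔖, IsLocTrivOn f S)
    (t0 : EuclideanSpace ℝ (Fin n)) (r : ℝ) (hr : 0 < r)
    (hD : ∀ S ∈ 𝔖, (S ∩ Metric.ball t0 r).Nonempty →
      ContractibleSpace ↥(S ∩ Metric.ball t0 r) ∧ t0 ∈ closure (S ∩ Metric.ball t0 r))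
    (S : Set (EuclideanSpace ℝ (Fin n))) (hS : S ∈ 𝔖)
    (γ : I → EuclideanSpace ℝ (Fin n)) (hγc : Continuous γ)
    (hγi : Function.Injective γ) (hγ0 : γ 0 = t0)
    (hγS : ∀ s : I, s ≠ 0 → γ s ∈ S ∩ Metric.ball t0 r)
    (i : ℕ) (g : ↥(SphS i) × I → EuclideanSpace ℝ (Fin m))
    (hg : IsVanishingCycle f γ i g) (hgnt : ¬ VanishingCycleTrivial f γ i g)
    (x0 : EuclideanSpace ℝ (Fin m)) (hx0 : x0 ∈ f ⁻¹' {t0})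
    (hx0comp : (connectedComponentIn (f ⁻¹' {t0}) x0 ∩
      Set.range fun x : ↥(SphS i) => g (x, 0)).Nonempty) :
    ¬ RelPiTrivial i (f ⁻¹' (Set.range γ)) (f ⁻¹' {t0}) x0 := by
  intro hπ
  obtain ⟨_, hw, z, rfl⟩ := hx0comp
  have hjoin := (hf.joinedIn_fiber hx0 hw).symm
  refine hgnt ?_
  rw [VanishingCycleTrivial, hγ0]
  refine hπ.nullHomotopicIn (preimage_mono ?_) (hg.1.comp (by fun_prop)) (fun w => ?_) hjoin
    hg.nullHomotopicIn_preimage_range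
  · exact singleton_subset_iff.2 ⟨0, hγ0⟩
  · exact (hg.2.1 w 0).trans hγ0
end
end

section
/- Let f: ℝ^m → ℝ^n be a polynomial map with m > n and let t_0 ∈ ℝ^n be a regular value of f (i.e., the total derivative Df(x): ℝ^m → ℝ^n is surjective at every x ∈ f^{-1}(t_0)). Then there exists a real number R > 0 such that: (1) for every r ≥ R, the fiber f^{-1}(t_0) is transverse to the sphere ∂B_r, i.e., at every x ∈ f^{-1}(t_0) with ‖x‖ = r the derivative of the map x ↦ (f(x), ‖x‖²) from ℝ^m to ℝ^n × ℝ is surjective; and (2) for every r ≥ R, the set f^{-1}(t_0) ∖ B_r is homeomorphic to (f^{-1}(t_0) ∩ ∂B_r) × ℝ. -/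
open scoped unitInterval
open Set Filter Topology Metric

noncomputable section

open TensorProduct in
theorem Transcendental.exists_derivation_ne_zero {k K : Type*} [Field k] [CharZero k]
    [Field K] [Algebra k K] {g : K}
    (hg : Transcendental k g) : ∃ D : Derivation k K K, D g ≠ 0 := by
  classical
  have hg' : AlgebraicIndepOn k id ({g} : Set K) := by
    have := (algebraicIndependent_singleton_iff (R := k) (x := fun i : ({g} : Set K) => (i : K))
      ⟨g, rfl⟩).2 hg
    exact this
  obtain ⟨s, hgs, hs⟩ := exists_isTranscendenceBasis_superset hg'
  let S := MvPolynomial s k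
  let φ : S →ₐ[k] K := MvPolynomial.aeval (fun i : s => (i : K))
  have hinj : Function.Injective φ := hs.1
  let : Algebra S K := φ.toRingHom.toAlgebra
  have : IsScalarTower k S K := .of_algebraMap_eq fun r => (φ.commutes r).symm
  have : FaithfulSMul S K := (faithfulSMul_iff_algebraMap_injective S K).2 hinj
  have : Algebra.IsAlgebraic S K := by
    have h1 := hs.isAlgebraic
    exact Algebra.IsAlgebraic.of_ringHom_of_comp_eq (R := S)
      (S := Algebra.adjoin k (Set.range (Subtype.val : s → K)))
      hs.1.aevalEquiv (RingHom.id K) hs.1.aevalEquiv.surjective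
      Function.injective_id (by ext <;> simp [S, φ, RingHom.algebraMap_toAlgebra])
  let F := FractionRing S
  let : Algebra F K := FractionRing.liftAlgebra S K
  have : IsScalarTower S F K := FractionRing.isScalarTower_liftAlgebra S K
  have : Algebra.IsAlgebraic F K := (IsFractionRing.comap_isAlgebraic_iff (A := S)).1 inferInstance
  have : CharZero S := inferInstance
  have : CharZero F := charZero_of_injective_algebraMap (IsFractionRing.injective S F)
  have : Algebra.FormallyEtale S F := .of_isLocalization (nonZeroDivisors S)
  have : Algebra.FormallyEtale F K := .of_isSeparable F K
  have : Algebra.FormallyEtale S K := .comp S F K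
  let d : Derivation k S K :=
    MvPolynomial.mkDerivation k fun i => if i = (⟨g, hgs rfl⟩ : s) then 1 else 0
  let e := KaehlerDifferential.tensorKaehlerEquivOfFormallyEtale k S K
  let l : Ω[K⁄k] →ₗ[K] K := (d.liftKaehlerDifferential.liftBaseChange K) ∘ₗ e.symm.toLinearMap
  refine ⟨l.compDer (KaehlerDifferential.D k K), ?_⟩
  have hX : g = algebraMap S K (MvPolynomial.X ⟨g, hgs rfl⟩) := by
    simp [RingHom.algebraMap_toAlgebra, φ, S]
  have : l (KaehlerDifferential.D k K g) = 1 := by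
    rw [hX]
    simp only [l, e, LinearMap.comp_apply, LinearEquiv.coe_coe,
      KaehlerDifferential.tensorKaehlerEquivOfFormallyEtale_symm_D_algebraMap]
    simp [d, S, LinearMap.liftBaseChange_tmul]
  change l (KaehlerDifferential.D k K g) ≠ 0
  rw [this]; exact one_ne_zero

theorem Derivation.map_mvPolynomial_aeval {k K ι : Type*} [Fintype ι] [CommRing k] [CommRing K]
    [Algebra k K] (D : Derivation k K K) (y : ι → K) (P : MvPolynomial ι k) :
    D (MvPolynomial.aeval y P) =
      ∑ i, MvPolynomial.aeval y (MvPolynomial.pderiv i P) * D (y i) := by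
  classical
  induction P using MvPolynomial.induction_on with
  | C a => simp
  | add p q hp hq => simp [hp, hq, add_mul, Finset.sum_add_distrib]
  | mul_X p j hp =>
    simp only [map_mul, MvPolynomial.aeval_X, Derivation.leibniz, hp, smul_eq_mul,
      MvPolynomial.pderiv_X, map_add, add_mul, Finset.sum_add_distrib, Finset.mul_sum]
    congr 1
    · rw [Finset.sum_eq_single j]
      · simp
      · intro b _ hb
        simp [hb.symm]
      · simp
    · exact Finset.sum_congr rfl fun i _ => by ring

theorem MvPolynomial.isAlgebraic_aeval_of_lagrange {k K ι τ : Type*} [Field k] [CharZero k]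
    [Field K] [Algebra k K] [Fintype ι] [Fintype τ] (F : τ → MvPolynomial ι k)
    (G : MvPolynomial ι k) (t : τ → k) (y : ι → K) (ν : τ → K)
    (hF : ∀ j, MvPolynomial.aeval y (F j) = algebraMap k K (t j))
    (hG : ∀ i, MvPolynomial.aeval y (MvPolynomial.pderiv i G) =
      ∑ j, ν j * MvPolynomial.aeval y (MvPolynomial.pderiv i (F j))) :
    IsAlgebraic k (MvPolynomial.aeval y G) := by
  by_contra htr
  obtain ⟨D, hD⟩ := Transcendental.exists_derivation_ne_zero htr
  have hDF : ∀ j, ∑ i, MvPolynomial.aeval y (MvPolynomial.pderiv i (F j)) * D (y i) = 0 := by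
    intro j
    rw [← D.map_mvPolynomial_aeval, hF, D.map_algebraMap]
  apply hD
  rw [D.map_mvPolynomial_aeval]
  simp only [hG, Finset.sum_mul]
  rw [Finset.sum_comm]
  refine Finset.sum_eq_zero fun j _ => ?_
  simp only [mul_assoc, ← Finset.mul_sum, hDF, mul_zero]

/-- The Lagrange-multiplier critical values of a polynomial `G` restricted to a fibre of a
polynomial map `F` are roots of a single nonzero univariate polynomial. -/
theorem MvPolynomial.exists_polynomial_eval_eq_zero_of_lagrange {k ι τ C : Type*} [Field k]
    [CharZero k] [Fintype ι] [Fintype τ] (F : τ → MvPolynomial ι k) (G : MvPolynomial ι k)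
    (t : τ → k) (x : C → ι → k) (μ : C → τ → k)
    (hF : ∀ c j, MvPolynomial.eval (x c) (F j) = t j)
    (hG : ∀ c i, MvPolynomial.eval (x c) (MvPolynomial.pderiv i G) =
      ∑ j, μ c j * MvPolynomial.eval (x c) (MvPolynomial.pderiv i (F j))) :
    ∃ p : Polynomial k, p ≠ 0 ∧ ∀ c, p.eval (MvPolynomial.eval (x c) G) = 0 := by
  by_contra! hcon
  let X : ι → C → k := fun i c => x c i
  have hev : ∀ Q : MvPolynomial ι k,
      MvPolynomial.aeval X Q = fun c => MvPolynomial.eval (x c) Q := by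
    intro Q
    funext c
    have := MvPolynomial.comp_aeval_apply X (Pi.evalAlgHom k (fun _ : C => k) c) Q
    simpa [MvPolynomial.aeval_eq_eval, X] using this
  let g : C → k := fun c => MvPolynomial.eval (x c) G
  let M : Submonoid (C → k) :=
    (nonZeroDivisors (Polynomial k)).map (Polynomial.aeval (R := k) g)
  have hdisj : Disjoint ((⊥ : Ideal (C → k)) : Set (C → k)) M := by
    rw [Set.disjoint_left]
    rintro _ h0 ⟨p, hp, rfl⟩
    obtain ⟨c, hc⟩ := hcon p (nonZeroDivisors.ne_zero hp)
    apply hc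
    have h1 := congrFun (show Polynomial.aeval g p = 0 from h0) c
    have h2 := Polynomial.aeval_algHom_apply (Pi.evalAlgHom k (fun _ : C => k) c) g p
    change Polynomial.aeval (g c) p = Polynomial.aeval g p c at h2
    rwa [h1, Polynomial.coe_aeval_eq_eval] at h2
  obtain ⟨P, hP, -, hPM⟩ := Ideal.exists_le_prime_disjoint _ M hdisj
  let q : (C → k) →ₐ[k] FractionRing ((C → k) ⧸ P) :=
    (IsScalarTower.toAlgHom k ((C → k) ⧸ P) (FractionRing ((C → k) ⧸ P))).comp
      (Ideal.Quotient.mkₐ k P)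
  have hq : ∀ r : C → k, q r = 0 → r ∈ P := by
    intro r hr
    have h0 : algebraMap ((C → k) ⧸ P) (FractionRing ((C → k) ⧸ P)) (Ideal.Quotient.mk P r) = 0 :=
      hr
    rw [← map_zero (algebraMap ((C → k) ⧸ P) (FractionRing ((C → k) ⧸ P)))] at h0
    exact Ideal.Quotient.eq_zero_iff_mem.1 (IsFractionRing.injective _ _ h0)
  have hy : ∀ Q : MvPolynomial ι k, MvPolynomial.aeval (fun i => q (X i)) Q =
      q (fun c => MvPolynomial.eval (x c) Q) := by
    intro Q
    rw [← hev Q]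
    exact (MvPolynomial.comp_aeval_apply X q Q).symm
  have halg := MvPolynomial.isAlgebraic_aeval_of_lagrange F G t (fun i => q (X i))
    (fun j => q fun c => μ c j)
    (fun j => by
      rw [hy, ← AlgHom.commutes q]
      congr 1
      funext c
      simp [hF])
    (fun i => by
      simp only [hy, ← map_mul, ← map_sum]
      congr 1
      funext c
      simp [hG, Finset.sum_apply])
  rw [hy] at halg
  obtain ⟨p, hp0, hp⟩ := halg
  rw [Polynomial.aeval_algHom_apply] at hp
  exact Set.disjoint_left.1 hPM (hq _ hp) ⟨p, mem_nonZeroDivisors_of_ne_zero hp0, rfl⟩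

section Flow

variable {E : Type*} [NormedAddCommGroup E] [NormedSpace ℝ E]

open scoped NNReal

theorem LipschitzWith.exists_integralCurve_Ioo [CompleteSpace E] {v : E → E} {K L : ℝ≥0}
    (hv : LipschitzWith K v) (hL : ∀ x, ‖v x‖ ≤ L) (x : E) (T : ℝ≥0) :
    ∃ α : ℝ → E, α 0 = x ∧ ∀ t ∈ Ioo (-T : ℝ) T, HasDerivAt α (v (α t)) t := by
  have h0 : (0 : ℝ) ∈ Icc (-T : ℝ) T := by simp
  have hpl : IsPicardLindelof (fun _ ↦ v) (⟨0, h0⟩ : Icc (-T : ℝ) T) x (L * T) 0 L K :=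
    IsPicardLindelof.of_time_independent (fun x _ ↦ hL x) hv.lipschitzOnWith (by simp)
  obtain ⟨α, h1, h2⟩ := hpl.exists_eq_forall_mem_Icc_hasDerivWithinAt₀
  exact ⟨α, h1, fun t ht ↦
    (h2 t (Ioo_subset_Icc_self ht)).hasDerivAt (Icc_mem_nhds ht.1 ht.2)⟩

theorem LipschitzWith.exists_integralCurve [CompleteSpace E] {v : E → E} {K L : ℝ≥0}
    (hv : LipschitzWith K v) (hL : ∀ x, ‖v x‖ ≤ L) (x : E) :
    ∃ α : ℝ → E, α 0 = x ∧ ∀ t, HasDerivAt α (v (α t)) t := by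
  choose α h0 h1 using fun k : ℕ ↦ hv.exists_integralCurve_Ioo hL x (k + 1)
  have heq : ∀ (j k : ℕ) (t : ℝ), j ≤ k → |t| < j + 1 → α j t = α k t := by
    intro j k t hjk ht
    have hjk' : (j : ℝ) ≤ k := by exact_mod_cast hjk
    refine ODE_solution_unique_of_mem_Ioo (v := fun _ ↦ v) (s := fun _ ↦ univ) (K := K)
      (a := -((j : ℝ) + 1)) (b := j + 1) (t₀ := 0) (fun _ _ ↦ hv.lipschitzOnWith) ?_
      (fun s hs ↦ ⟨h1 j s (by simpa using hs), trivial⟩)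
      (fun s hs ↦ ⟨h1 k s (by
        have := hs.1; have := hs.2
        push_cast; constructor <;> linarith), trivial⟩) ((h0 j).trans (h0 k).symm) (abs_lt.1 ht)
    have : (0 : ℝ) < j + 1 := by positivity
    exact ⟨by linarith, this⟩
  refine ⟨fun t ↦ α ⌊|t|⌋₊ t, h0 _, fun t ↦ ?_⟩
  have ht : |t| < (⌊|t|⌋₊ : ℝ) + 1 := Nat.lt_floor_add_one _
  have hev : ∀ᶠ s in 𝓝 t, |s| < (⌊|t|⌋₊ : ℝ) + 1 := continuous_abs.continuousAt.eventually_lt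
    continuousAt_const ht
  refine (h1 ⌊|t|⌋₊ t ?_).congr_of_eventuallyEq ?_
  · simpa using abs_lt.1 ht
  · filter_upwards [hev] with s hs
    refine heq _ _ _ ?_ (Nat.lt_floor_add_one _)
    have := (Nat.floor_lt (abs_nonneg s)).2 (by exact_mod_cast hs : |s| < ((⌊|t|⌋₊ + 1 : ℕ) : ℝ))
    omega

theorem dist_integralCurve_le_mul_exp {v : E → E} {K : ℝ≥0} (hv : LipschitzWith K v)
    {α β : ℝ → E} (hα : ∀ t, HasDerivAt α (v (α t)) t) (hβ : ∀ t, HasDerivAt β (v (β t)) t)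
    (t : ℝ) : dist (α t) (β t) ≤ dist (α 0) (β 0) * Real.exp (K * |t|) := by
  have key : ∀ {w : E → E} (_ : LipschitzWith K w) {α β : ℝ → E}
      (_ : ∀ t, HasDerivAt α (w (α t)) t) (_ : ∀ t, HasDerivAt β (w (β t)) t) (t : ℝ), 0 ≤ t →
      dist (α t) (β t) ≤ dist (α 0) (β 0) * Real.exp (K * t) := by
    intro w hw α β hα hβ t ht
    have := dist_le_of_trajectories_ODE (v := fun _ ↦ w) (K := K) (a := 0) (b := t)
      (fun _ ↦ hw) (fun s _ ↦ (hα s).continuousAt.continuousWithinAt)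
      (fun s _ ↦ (hα s).hasDerivWithinAt) (fun s _ ↦ (hβ s).continuousAt.continuousWithinAt)
      (fun s _ ↦ (hβ s).hasDerivWithinAt) le_rfl t ⟨ht, le_rfl⟩
    simpa using this
  rcases le_total 0 t with ht | ht
  · simpa [abs_of_nonneg ht] using key hv hα hβ t ht
  · have hrev : ∀ {α : ℝ → E} (_ : ∀ t, HasDerivAt α (v (α t)) t) (t : ℝ),
        HasDerivAt (fun s ↦ α (-s)) (-v (α (-t))) t := fun hα t ↦ by
      simpa [Function.comp_def] using (hα (-t)).scomp t (hasDerivAt_neg t)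
    have := key (w := fun x ↦ -v x) hv.neg (hrev hα) (hrev hβ) (-t) (by linarith)
    simpa [abs_of_nonpos ht] using this

/-- A bounded Lipschitz vector field on a Banach space has a global continuous flow. -/
theorem LipschitzWith.exists_flow [CompleteSpace E] {v : E → E} {K L : ℝ≥0}
    (hv : LipschitzWith K v) (hL : ∀ x, ‖v x‖ ≤ L) :
    ∃ Φ : Flow ℝ E, ∀ x t, HasDerivAt (fun s ↦ Φ s x) (v (Φ t x)) t := by
  choose α h0 h1 using hv.exists_integralCurve hL
  have hcont : Continuous fun p : E × ℝ ↦ α p.1 p.2 := by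
    refine continuous_prod_of_continuous_lipschitzWith' _ L ?_ ?_
    · intro x
      refine lipschitzWith_of_nnnorm_deriv_le (𝕜 := ℝ) (fun t ↦ (h1 x t).differentiableAt) fun t ↦ ?_
      rw [(h1 x t).deriv]
      exact hL _
    · intro t
      refine (LipschitzWith.of_dist_le_mul (K := (Real.exp (K * |t|)).toNNReal) fun x y ↦
        ?_).continuous
      have := dist_integralCurve_le_mul_exp hv (h1 x) (h1 y) t
      rw [Real.coe_toNNReal _ (Real.exp_pos _).le, mul_comm]
      simpa [h0] using this
  refine ⟨⟨fun t x ↦ α x t, ?_, ?_, h0⟩, h1⟩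
  · exact hcont.comp continuous_swap
  · intro t₁ t₂ x
    have : (fun s ↦ α x (s + t₂)) = α (α x t₂) := by
      refine ODE_solution_unique_univ (v := fun _ ↦ v) (s := fun _ ↦ univ) (K := K) (t₀ := 0)
        (fun _ ↦ hv.lipschitzOnWith) (fun t ↦ ⟨?_, trivial⟩) (fun t ↦ ⟨h1 _ t, trivial⟩)
        (by simp [h0])
      exact (h1 x (t + t₂)).comp_add_const t t₂
    exact congrFun this t₁

end Flow

section FlowProduct

variable {E : Type*} [TopologicalSpace E]

/-- If a function `h` is nondecreasing along a flow on an invariant set `V`, with positive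
derivative wherever `c ≤ h`, and the sets `V ∩ {c ≤ h ≤ b}` are compact, then `V ∩ {c < h}` is
homeomorphic to `(V ∩ {h = c}) × ℝ`. -/
theorem Flow.nonempty_homeomorph_prod_real (Φ : Flow ℝ E) {V : Set E} {h h' : E → ℝ} {c : ℝ}
    (hV : ∀ x ∈ V, ∀ t, Φ t x ∈ V) (hcont : Continuous h) (hcont' : Continuous h')
    (hderiv : ∀ x ∈ V, ∀ t, HasDerivAt (fun s ↦ h (Φ s x)) (h' (Φ t x)) t)
    (hnonneg : ∀ x ∈ V, 0 ≤ h' x) (hpos : ∀ x ∈ V, c ≤ h x → 0 < h' x)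
    (hcompact : ∀ b, IsCompact (V ∩ h ⁻¹' Icc c b)) :
    Nonempty (↥(V ∩ {x | c < h x}) ≃ₜ ↥(V ∩ {x | h x = c}) × ℝ) := by
  have mono : ∀ x ∈ V, Monotone fun s ↦ h (Φ s x) := fun x hx ↦
    monotone_of_hasDerivAt_nonneg (hderiv x hx) fun t ↦ hnonneg _ (hV x hx t)
  have strict : ∀ x ∈ V, ∀ s t, s < t → c ≤ h (Φ s x) → h (Φ s x) < h (Φ t x) := by
    intro x hx s t hst hs
    refine strictMonoOn_of_deriv_pos (convex_Ici s)
      (fun r _ ↦ (hderiv x hx r).continuousAt.continuousWithinAt) (fun r hr ↦ ?_)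
      (self_mem_Ici) hst.le hst
    rw [(hderiv x hx r).deriv]
    rw [interior_Ici] at hr
    exact hpos _ (hV x hx r) (hs.trans (mono x hx (le_of_lt hr)))
  have inj : ∀ x ∈ V, ∀ s t, h (Φ s x) = c → h (Φ t x) = c → s = t := by
    intro x hx s t hs ht
    rcases lt_trichotomy s t with hst | hst | hst
    · exact absurd (strict x hx s t hst hs.ge) (by rw [hs, ht]; exact lt_irrefl _)
    · exact hst
    · exact absurd (strict x hx t s hst ht.ge) (by rw [hs, ht]; exact lt_irrefl _)
  have hit : ∀ x ∈ V, c < h x → ∃ t, 0 < t ∧ h (Φ (-t) x) = c := by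
    intro x hx hxc
    by_contra! hne
    have hgt : ∀ t, 0 ≤ t → c < h (Φ (-t) x) := by
      intro t ht
      by_contra! hle
      obtain ⟨s, hs, hsc⟩ := intermediate_value_Icc' (f := fun s ↦ h (Φ (-s) x)) ht
        (by fun_prop) ⟨hle, by simpa using hxc.le⟩
      rcases hs.1.eq_or_lt with rfl | hs0
      · simp only [neg_zero, Flow.map_zero_apply] at hsc
        exact hxc.ne' hsc
      · exact hne s hs0 hsc
    obtain ⟨y, ⟨hyV, hy⟩, hmin⟩ := (hcompact (h x)).exists_isMinOn
      ⟨x, hx, hxc.le, le_rfl⟩ hcont'.continuousOn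
    have hδ : 0 < h' y := hpos y hyV hy.1
    set T := (h x - c) / h' y with hT
    have hT0 : 0 < T := div_pos (by linarith) hδ
    have := (convex_Icc (-T) 0).mul_sub_le_image_sub_of_le_deriv (f := fun s ↦ h (Φ s x))
      (C := h' y) (fun r _ ↦ (hderiv x hx r).continuousAt.continuousWithinAt)
      (fun r _ ↦ (hderiv x hx r).differentiableAt.differentiableWithinAt) (fun r hr ↦ by
        rw [interior_Icc] at hr
        rw [(hderiv x hx r).deriv]
        refine hmin ⟨hV x hx r, ?_, ?_⟩
        · simpa using (hgt (-r) (by linarith [hr.2])).le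
        · simpa using mono x hx hr.2.le) (-T) ⟨le_rfl, by linarith⟩ 0 ⟨by linarith, le_rfl⟩
        (by linarith)
    have h1 := hgt T hT0.le
    have h2 : h' y * T = h x - c := by rw [hT]; field_simp
    simp only [Flow.map_zero_apply] at this
    linarith
  choose τ τpos hτ using fun x : ↥(V ∩ {x | c < h x}) ↦ hit x x.2.1 x.2.2
  have τcont : Continuous τ := by
    refine continuous_iff_continuousAt.2 fun x ↦ tendsto_order.2 ⟨fun a ha ↦ ?_, fun b hb ↦ ?_⟩
    · have hx : c < h (Φ (-a) x) :=
        (hτ x).symm.trans_lt (strict x x.2.1 _ _ (by linarith) (hτ x).ge)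
      have : ∀ᶠ y : ↥(V ∩ {x | c < h x}) in 𝓝 x, c < h (Φ (-a) y) :=
        (continuousAt_const.eventually_lt
          (f := fun _ : ↥(V ∩ {x | c < h x}) ↦ c) (by fun_prop) hx)
      filter_upwards [this] with y hy
      by_contra! hle
      exact absurd (mono y y.2.1 (neg_le_neg hle)) (by simpa only [hτ y, not_le] using hy)
    · have hx : h (Φ (-b) x) < c := by
        by_contra! hle
        exact absurd (strict x x.2.1 (-b) (-τ x) (by linarith) hle)
          (by rw [hτ x]; exact hle.not_gt)
      have : ∀ᶠ y : ↥(V ∩ {x | c < h x}) in 𝓝 x, h (Φ (-b) y) < c :=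
        (ContinuousAt.eventually_lt (g := fun _ : ↥(V ∩ {x | c < h x}) ↦ c)
          (by fun_prop) continuousAt_const hx)
      filter_upwards [this] with y hy
      by_contra! hle
      exact absurd (mono y y.2.1 (neg_le_neg hle)) (by simpa only [hτ y, not_le] using hy)
  have hexp : ∀ (y : ↥(V ∩ {x | h x = c})) (s : ℝ), c < h (Φ (Real.exp s) y) := by
    intro y s
    have h0 : h (Φ 0 (y : E)) = c := by rw [Flow.map_zero_apply]; exact y.2.2
    exact h0.symm.trans_lt (strict y y.2.1 _ _ (Real.exp_pos s) h0.ge)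
  refine ⟨⟨⟨fun x ↦ (⟨Φ (-τ x) x, hV x x.2.1 _, hτ x⟩, Real.log (τ x)),
    fun p ↦ ⟨Φ (Real.exp p.2) p.1, hV _ p.1.2.1 _, hexp p.1 p.2⟩, fun x ↦ ?_, fun p ↦ ?_⟩,
    ?_, ?_⟩⟩
  · ext
    simp only [Real.exp_log (τpos x), ← Flow.map_add, add_neg_cancel, Flow.map_zero_apply]
  · have : τ ⟨Φ (Real.exp p.2) p.1, hV _ p.1.2.1 _, hexp p.1 p.2⟩ = Real.exp p.2 := by
      refine neg_injective (inj _ (hV _ p.1.2.1 (Real.exp p.2)) _ _ (hτ ⟨_, _⟩) ?_)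
      rw [← Flow.map_add, neg_add_cancel, Flow.map_zero_apply]
      exact p.1.2.2
    refine Prod.ext (Subtype.ext ?_) ?_
    · simp only [this, ← Flow.map_add, neg_add_cancel, Flow.map_zero_apply]
    · simp only [this, Real.log_exp]
  · have : Continuous fun x : ↥(V ∩ {x | c < h x}) ↦ Real.log (τ x) :=
      τcont.log fun x ↦ (τpos x).ne'
    exact (Continuous.subtype_mk (by fun_prop) _).prodMk this
  · exact Continuous.subtype_mk (by fun_prop) _

end FlowProduct

section Polynomial

theorem MvPolynomial.hasTemperateGrowth_eval {ι : Type*} [Fintype ι] (P : MvPolynomial ι ℝ) :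
    (fun x : EuclideanSpace ℝ ι ↦ eval (fun k ↦ x k) P).HasTemperateGrowth := by
  induction P using MvPolynomial.induction_on with
  | C a => simp
  | add p q hp hq => simpa using hp.fun_add hq
  | mul_X p i hp =>
    simpa using hp.fun_mul
      (EuclideanSpace.proj i : EuclideanSpace ℝ ι →L[ℝ] ℝ).hasTemperateGrowth

theorem MvPolynomial.hasFDerivAt_eval {ι : Type*} [Fintype ι] (P : MvPolynomial ι ℝ)
    (x : EuclideanSpace ℝ ι) :
    HasFDerivAt (fun x : EuclideanSpace ℝ ι ↦ eval (fun k ↦ x k) P)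
      (∑ k, eval (fun k ↦ x k) (pderiv k P) •
        (EuclideanSpace.proj k : EuclideanSpace ℝ ι →L[ℝ] ℝ)) x := by
  classical
  induction P using MvPolynomial.induction_on with
  | C a => simpa using hasFDerivAt_const a x
  | add p q hp hq => simpa [add_smul, Finset.sum_add_distrib] using hp.fun_add hq
  | mul_X p i hp =>
    have h := hp.fun_mul (EuclideanSpace.proj i : EuclideanSpace ℝ ι →L[ℝ] ℝ).hasFDerivAt
    simp only [PiLp.proj_apply] at h
    simp only [map_mul, eval_X]
    refine h.congr_fderiv ?_
    ext v
    simp [pderiv_X, Pi.single_apply, add_mul, Finset.sum_add_distrib, Finset.mul_sum, mul_assoc,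
      apply_ite, ite_mul]

/-- Dividing a function of temperate growth by a large power of `1 + ‖x‖ ^ 2` gives a bounded
Lipschitz function. -/
theorem Function.HasTemperateGrowth.exists_lipschitzWith_inv_pow_smul {E F : Type*}
    [NormedAddCommGroup E] [InnerProductSpace ℝ E] [NormedAddCommGroup F] [NormedSpace ℝ F]
    {W : E → F} (hW : W.HasTemperateGrowth) :
    ∃ (N : ℕ) (K L : NNReal), LipschitzWith K (fun x ↦ ((1 + ‖x‖ ^ 2) ^ N)⁻¹ • W x) ∧
      ∀ x, ‖((1 + ‖x‖ ^ 2) ^ N)⁻¹ • W x‖ ≤ L := by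
  obtain ⟨k, C, hC, hbound⟩ := hW.norm_iteratedFDeriv_le_uniform 1
  have hQ : ∀ x : E, 0 < 1 + ‖x‖ ^ 2 := fun x ↦ by positivity
  have hle : ∀ x : E, C * (1 + ‖x‖) ^ k ≤ C * 2 ^ k * (1 + ‖x‖ ^ 2) ^ k := fun x ↦ by
    rw [mul_assoc, ← mul_pow]
    gcongr
    nlinarith [sq_nonneg (‖x‖ - 1), sq_nonneg ‖x‖]
  have h0 : ∀ x, ‖W x‖ ≤ C * 2 ^ k * (1 + ‖x‖ ^ 2) ^ k := fun x ↦ by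
    simpa using (hbound 0 (by simp) x).trans (hle x)
  have h1 : ∀ x, ‖fderiv ℝ W x‖ ≤ C * 2 ^ k * (1 + ‖x‖ ^ 2) ^ k := fun x ↦ by
    simpa [norm_iteratedFDeriv_one] using (hbound 1 le_rfl x).trans (hle x)
  have hWd : Differentiable ℝ W := hW.1.differentiable (by simp)
  have hbd : ∀ x, ‖((1 + ‖x‖ ^ 2) ^ k)⁻¹ • W x‖ ≤ C * 2 ^ k := fun x ↦ by
    rw [norm_smul, norm_inv, Real.norm_of_nonneg (by positivity), inv_mul_le_iff₀ (by positivity),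
      mul_comm]
    exact h0 x
  have hbd1 : ∀ x, ‖((1 + ‖x‖ ^ 2) ^ k)⁻¹ • fderiv ℝ W x‖ ≤ C * 2 ^ k := fun x ↦ by
    rw [norm_smul, norm_inv, Real.norm_of_nonneg (by positivity), inv_mul_le_iff₀ (by positivity),
      mul_comm]
    exact h1 x
  have hpow : ∀ x : E, HasFDerivAt (fun x : E ↦ ((1 + ‖x‖ ^ 2) ^ k)⁻¹)
      ((-k * ((1 + ‖x‖ ^ 2) ^ (k + 1))⁻¹ : ℝ) • (2 : ℕ) • innerSL ℝ x) x := fun x ↦ by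
    have hn : HasFDerivAt (fun x : E ↦ 1 + ‖x‖ ^ 2) ((2 : ℕ) • innerSL ℝ x) x := by
      simpa using (hasStrictFDerivAt_norm_sq x).hasFDerivAt.const_add 1
    have hz := (hasDerivAt_zpow (-(k : ℤ)) _ (Or.inl (hQ x).ne')).comp_hasFDerivAt x hn
    have he : (1 + ‖x‖ ^ 2) ^ (-(k : ℤ) - 1) = ((1 + ‖x‖ ^ 2) ^ (k + 1))⁻¹ := by
      rw [← zpow_natCast _ (k + 1), ← zpow_neg]
      push_cast
      ring_nf
    rw [he] at hz
    simpa [Function.comp_def] using hz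
  have hderiv := fun x ↦ (hpow x).fun_smul (hWd x).hasFDerivAt
  refine ⟨k, ⟨(C * 2 ^ k) * (k + 1), by positivity⟩, ⟨C * 2 ^ k, by positivity⟩, ?_, hbd⟩
  refine lipschitzWith_of_nnnorm_fderiv_le (𝕜 := ℝ) (fun x ↦ (hderiv x).differentiableAt) fun x ↦ ?_
  rw [(hderiv x).fderiv]
  change ‖_‖ ≤ (C * 2 ^ k) * (k + 1 : ℝ)
  have hx : ‖((-k * ((1 + ‖x‖ ^ 2) ^ (k + 1))⁻¹ : ℝ) • (2 : ℕ) • innerSL ℝ x).smulRight (W x)‖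
      ≤ k * (C * 2 ^ k) := by
    have h2 : ‖(2 : ℕ) • innerSL ℝ x‖ ≤ 1 + ‖x‖ ^ 2 := by
      refine (norm_nsmul_le).trans ?_
      rw [innerSL_apply_norm, Nat.cast_ofNat]
      nlinarith [sq_nonneg (‖x‖ - 1)]
    rw [ContinuousLinearMap.norm_smulRight_apply, norm_smul, norm_mul, norm_neg, norm_inv,
      Real.norm_of_nonneg (by positivity : 0 ≤ (1 + ‖x‖ ^ 2) ^ (k + 1)), Real.norm_natCast]
    calc k * ((1 + ‖x‖ ^ 2) ^ (k + 1))⁻¹ * ‖(2 : ℕ) • innerSL ℝ x‖ * ‖W x‖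
        ≤ k * ((1 + ‖x‖ ^ 2) ^ (k + 1))⁻¹ * (1 + ‖x‖ ^ 2) *
          (C * 2 ^ k * (1 + ‖x‖ ^ 2) ^ k) := by
          gcongr
          exact h0 x
      _ = k * (C * 2 ^ k) := by
          have := (hQ x).ne'
          field_simp
          ring
  linarith [norm_add_le_of_le (hbd1 x) hx]

end Polynomial

section GramDeterminant

open Matrix

theorem Matrix.mulVec_transpose_mulVec_adjugate_mulVec {m n R : Type*} [Fintype m] [Fintype n]
    [DecidableEq m] [CommRing R] (A : Matrix m n R) (v : m → R) :
    A *ᵥ (Aᵀ *ᵥ ((A * Aᵀ).adjugate *ᵥ v)) = (A * Aᵀ).det • v := by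
  rw [mulVec_mulVec, mulVec_mulVec, Matrix.mul_adjugate, smul_mulVec, one_mulVec]

theorem Matrix.det_mul_transpose_self_nonneg {m n : Type*} [Fintype m] [Fintype n] [DecidableEq m]
    (A : Matrix m n ℝ) : 0 ≤ (A * Aᵀ).det := by
  simpa using (posSemidef_self_mul_conjTranspose A).det_nonneg

theorem Matrix.exists_vecMul_eq_zero_of_det_mul_transpose_eq_zero {m n : Type*} [Fintype m]
    [Fintype n] [DecidableEq m] {A : Matrix m n ℝ} (hA : (A * Aᵀ).det = 0) :
    ∃ c, c ≠ 0 ∧ c ᵥ* A = 0 := by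
  obtain ⟨c, hc, h⟩ := exists_vecMul_eq_zero_iff.2 hA
  refine ⟨c, hc, ?_⟩
  rw [← vecMul_vecMul] at h
  have : (c ᵥ* A) ⬝ᵥ (c ᵥ* A) = 0 := by
    have := congrArg (· ⬝ᵥ c) h
    rwa [zero_dotProduct, ← dotProduct_mulVec, mulVec_transpose] at this
  exact dotProduct_self_eq_zero.1 this

theorem Matrix.mulVec_surjective_of_det_mul_transpose_ne_zero {m n K : Type*} [Fintype m]
    [Fintype n] [DecidableEq m] [Field K] {A : Matrix m n K} (hA : (A * Aᵀ).det ≠ 0) :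
    Function.Surjective (A *ᵥ ·) := fun v ↦
  ⟨Aᵀ *ᵥ ((A * Aᵀ).adjugate *ᵥ ((A * Aᵀ).det⁻¹ • v)), by
    simp only [mulVec_transpose_mulVec_adjugate_mulVec, smul_smul, mul_inv_cancel₀ hA, one_smul]⟩

namespace MvPolynomial

/-- The Jacobian matrix of a family of polynomials. -/
def gradMatrix {ι τ R : Type*} [CommSemiring R] (P : τ → MvPolynomial ι R) :
    Matrix τ ι (MvPolynomial ι R) :=
  Matrix.of fun i k ↦ pderiv k (P i)

variable {ι τ : Type*} [Fintype ι]

/-- The Jacobian matrix of a family of polynomials, evaluated at a point. -/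
def gradMatrixAt (P : τ → MvPolynomial ι ℝ) (x : EuclideanSpace ℝ ι) : Matrix τ ι ℝ :=
  (gradMatrix P).map (eval fun k ↦ x k)

theorem sum_eval_pderiv_smul_proj_apply (P : τ → MvPolynomial ι ℝ) (x v : EuclideanSpace ℝ ι)
    (i : τ) :
    (∑ k, eval (fun k ↦ x k) (pderiv k (P i)) •
        (EuclideanSpace.proj k : EuclideanSpace ℝ ι →L[ℝ] ℝ)) v = (gradMatrixAt P x *ᵥ v) i := by
  simp [gradMatrixAt, gradMatrix, mulVec, dotProduct]

variable [Fintype τ] [DecidableEq τ]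

/-- The vector field whose inner products with the gradients of the `P j` vanish for `j ≠ i`. -/
def dualField (P : τ → MvPolynomial ι ℝ) (i : τ) (x : EuclideanSpace ℝ ι) : EuclideanSpace ℝ ι :=
  WithLp.toLp 2 fun k ↦ eval (fun k ↦ x k)
    (((gradMatrix P)ᵀ *ᵥ ((gradMatrix P * (gradMatrix P)ᵀ).adjugate *ᵥ Pi.single i 1)) k)

theorem hasTemperateGrowth_dualField (P : τ → MvPolynomial ι ℝ) (i : τ) :
    (dualField P i).HasTemperateGrowth := by
  classical
  have : dualField P i = fun x ↦ ∑ k, (eval (fun k ↦ x k) (((gradMatrix P)ᵀ *ᵥ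
      ((gradMatrix P * (gradMatrix P)ᵀ).adjugate *ᵥ Pi.single i 1)) k)) •
        (EuclideanSpace.single k 1 : EuclideanSpace ℝ ι) := by
    funext x
    ext j
    simp [dualField, Pi.single_apply]
  rw [this]
  exact Function.HasTemperateGrowth.sum fun k _ ↦
    (hasTemperateGrowth_eval _).fun_smul (Function.HasTemperateGrowth.const _)

theorem gradMatrixAt_mulVec_dualField (P : τ → MvPolynomial ι ℝ) (i : τ)
    (x : EuclideanSpace ℝ ι) :
    gradMatrixAt P x *ᵥ dualField P i x =
      (gradMatrixAt P x * (gradMatrixAt P x)ᵀ).det • Pi.single i 1 := by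
  have h := mulVec_transpose_mulVec_adjugate_mulVec (gradMatrix P) (Pi.single i 1)
  have hdet : (gradMatrixAt P x * (gradMatrixAt P x)ᵀ).det =
      eval (fun k ↦ x k) (gradMatrix P * (gradMatrix P)ᵀ).det := by
    rw [RingHom.map_det, RingHom.mapMatrix_apply, Matrix.map_mul, transpose_map]
    rfl
  funext j
  have hj := congrArg (eval fun k ↦ x k) (congrFun h j)
  rw [RingHom.map_mulVec] at hj
  rw [hdet]
  refine hj.trans ?_
  rcases eq_or_ne j i with rfl | hji <;> simp [*]

theorem continuous_det_gradMatrixAt (P : τ → MvPolynomial ι ℝ) :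
    Continuous fun x ↦ (gradMatrixAt P x * (gradMatrixAt P x)ᵀ).det := by
  have : Continuous (gradMatrixAt P) := continuous_matrix fun i k ↦
    (hasTemperateGrowth_eval (pderiv k (P i))).1.continuous
  fun_prop

end MvPolynomial

end GramDeterminant

section Fiber

open MvPolynomial

/-- The sum of squares of the variables. -/
def MvPolynomial.normSq (ι : Type*) [Fintype ι] : MvPolynomial ι ℝ := ∑ k, X k ^ 2

theorem MvPolynomial.eval_normSq {ι : Type*} [Fintype ι] (x : EuclideanSpace ℝ ι) :
    eval (fun k ↦ x k) (normSq ι) = ‖x‖ ^ 2 := by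
  simp [normSq, EuclideanSpace.norm_sq_eq]

variable {m n : ℕ}

theorem differentiableAt_and_fderiv_apply (F : Fin n → MvPolynomial (Fin m) ℝ)
    {f : EuclideanSpace ℝ (Fin m) → EuclideanSpace ℝ (Fin n)}
    (hF : ∀ j x, f x j = eval (fun k ↦ x k) (F j)) (x : EuclideanSpace ℝ (Fin m)) :
    DifferentiableAt ℝ f x ∧ ∀ v j, fderiv ℝ f x v j = (gradMatrixAt F x).mulVec v j := by
  have hj : ∀ j, HasFDerivAt (fun x ↦ f x j) (∑ k, eval (fun k ↦ x k) (pderiv k (F j)) •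
      (EuclideanSpace.proj k : EuclideanSpace ℝ (Fin m) →L[ℝ] ℝ)) x := fun j ↦ by
    simpa only [hF] using hasFDerivAt_eval (F j) x
  have hd : DifferentiableAt ℝ f x := differentiableAt_euclidean.2 fun j ↦ (hj j).differentiableAt
  refine ⟨hd, fun v j ↦ ?_⟩
  have huniq := ((EuclideanSpace.proj j : EuclideanSpace ℝ (Fin n) →L[ℝ] ℝ).hasFDerivAt.comp x
    hd.hasFDerivAt).unique (hj j)
  rw [← sum_eval_pderiv_smul_proj_apply, ← huniq]
  rfl

/-- The polynomials `F j` together with the squared norm. -/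
def MvPolynomial.withNormSq {ι τ : Type*} [Fintype ι] (F : τ → MvPolynomial ι ℝ) :
    Option τ → MvPolynomial ι ℝ := fun o ↦ o.elim (normSq ι) F

/-- The Gram determinant of the gradients of the `F j` and of the squared norm. -/
def MvPolynomial.gramDet {ι τ : Type*} [Fintype ι] [Fintype τ] [DecidableEq τ]
    (F : τ → MvPolynomial ι ℝ) (x : EuclideanSpace ℝ ι) : ℝ :=
  (gradMatrixAt (withNormSq F) x * (gradMatrixAt (withNormSq F) x).transpose).det

open Matrix in
/-- Far away on a regular fiber, the spheres are transverse to the fiber. -/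
theorem exists_radius_gramDet_pos (F : Fin n → MvPolynomial (Fin m) ℝ)
    {f : EuclideanSpace ℝ (Fin m) → EuclideanSpace ℝ (Fin n)}
    (hF : ∀ j x, f x j = eval (fun k ↦ x k) (F j)) (t : EuclideanSpace ℝ (Fin n))
    (hreg : ∀ x, f x = t → Function.Surjective (fderiv ℝ f x)) :
    ∃ R : ℝ, 0 < R ∧ ∀ x, f x = t → R ≤ ‖x‖ → 0 < gramDet F x := by
  have hlag : ∀ c : {x // f x = t ∧ gramDet F x = 0}, ∃ μ : Fin n → ℝ, ∀ i,
      eval (fun k ↦ c.1 k) (pderiv i (normSq (Fin m))) =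
        ∑ j, μ j * eval (fun k ↦ c.1 k) (pderiv i (F j)) := by
    rintro ⟨x, hx, hdet⟩
    obtain ⟨c, hc0, hc⟩ := exists_vecMul_eq_zero_of_det_mul_transpose_eq_zero hdet
    have hrow : ∀ i, c none * eval (fun k ↦ x k) (pderiv i (normSq (Fin m))) +
        ∑ j, c (some j) * eval (fun k ↦ x k) (pderiv i (F j)) = 0 := fun i ↦ by
      simpa [vecMul, dotProduct, gradMatrixAt, gradMatrix, withNormSq] using congrFun hc i
    have hnone : c none ≠ 0 := by
      intro h0
      obtain ⟨v, hv⟩ := hreg x hx (WithLp.toLp 2 fun j ↦ c (some j))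
      have hs : (fun j ↦ c (some j)) ᵥ* gradMatrixAt F x = 0 := funext fun i ↦ by
        simpa [vecMul, dotProduct, gradMatrixAt, gradMatrix, h0] using hrow i
      have hv' : gradMatrixAt F x *ᵥ v = fun j ↦ c (some j) := funext fun j ↦ by
        rw [← (differentiableAt_and_fderiv_apply F hF x).2, hv]
      have : (fun j ↦ c (some j)) ⬝ᵥ (fun j ↦ c (some j)) = 0 := by
        nth_rewrite 2 [← hv']
        rw [dotProduct_mulVec, hs, zero_dotProduct]
      refine hc0 (funext fun o ↦ ?_)
      cases o with
      | none => exact h0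
      | some j => exact congrFun (dotProduct_self_eq_zero.1 this) j
    refine ⟨fun j ↦ -(c (some j) / c none), fun i ↦ ?_⟩
    have := hrow i
    rw [← mul_right_inj' hnone, Finset.mul_sum, eq_neg_of_add_eq_zero_left this,
      ← Finset.sum_neg_distrib]
    refine Finset.sum_congr rfl fun j _ ↦ ?_
    field_simp
  choose μ hμ using hlag
  obtain ⟨p, hp0, hp⟩ := exists_polynomial_eval_eq_zero_of_lagrange F (normSq (Fin m))
    (fun j ↦ t j) (fun c : {x // f x = t ∧ gramDet F x = 0} ↦ fun k ↦ c.1 k) μ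
    (fun c j ↦ by rw [← hF, c.2.1]) hμ
  obtain ⟨B, hB⟩ := p.roots.toFinset.bddAbove
  refine ⟨1 + |B|, by positivity, fun x hx hR ↦ ?_⟩
  refine lt_of_le_of_ne (det_mul_transpose_self_nonneg _) fun hdet ↦ ?_
  have hroot := hp ⟨x, hx, hdet.symm⟩
  rw [eval_normSq] at hroot
  have := hB (show ‖x‖ ^ 2 ∈ (p.roots.toFinset : Set ℝ) by simpa [hp0] using hroot)
  nlinarith [le_abs_self B, abs_nonneg B]

theorem fderiv_prodMk_norm_sq_surjective (F : Fin n → MvPolynomial (Fin m) ℝ)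
    {f : EuclideanSpace ℝ (Fin m) → EuclideanSpace ℝ (Fin n)}
    (hF : ∀ j x, f x j = eval (fun k ↦ x k) (F j)) {x : EuclideanSpace ℝ (Fin m)}
    (hx : gramDet F x ≠ 0) : Function.Surjective (fderiv ℝ (fun y ↦ (f y, ‖y‖ ^ 2)) x) := by
  rintro ⟨a, b⟩
  obtain ⟨v, hv⟩ := Matrix.mulVec_surjective_of_det_mul_transpose_ne_zero hx
    fun o : Option (Fin n) ↦ o.elim b a
  have hf := differentiableAt_and_fderiv_apply F hF x
  have hn := hasFDerivAt_eval (normSq (Fin m)) x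
  simp only [eval_normSq] at hn
  refine ⟨WithLp.toLp 2 v, ?_⟩
  rw [(hf.1.hasFDerivAt.prodMk hn).fderiv]
  refine Prod.ext ?_ ?_
  · ext j
    exact (hf.2 _ j).trans (congrFun hv (some j))
  · exact (sum_eval_pderiv_smul_proj_apply (withNormSq F) x (WithLp.toLp 2 v) none).trans
      (congrFun hv none)

theorem nonempty_homeomorph_fiber_sdiff_closedBall (F : Fin n → MvPolynomial (Fin m) ℝ)
    {f : EuclideanSpace ℝ (Fin m) → EuclideanSpace ℝ (Fin n)}
    (hF : ∀ j x, f x j = eval (fun k ↦ x k) (F j)) (t : EuclideanSpace ℝ (Fin n)) {r : ℝ}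
    (hr : 0 ≤ r) (hpos : ∀ x, f x = t → r ≤ ‖x‖ → 0 < gramDet F x) :
    Nonempty (↥(f ⁻¹' {t} \ closedBall (0 : EuclideanSpace ℝ (Fin m)) r) ≃ₜ
      ↥(f ⁻¹' {t} ∩ sphere (0 : EuclideanSpace ℝ (Fin m)) r) × ℝ) := by
  obtain ⟨N, K, L, hK, hL⟩ :=
    (hasTemperateGrowth_dualField (withNormSq F) none).exists_lipschitzWith_inv_pow_smul
  obtain ⟨Φ, hΦ⟩ := hK.exists_flow hL
  have hfc : Continuous f := continuous_iff_continuousAt.2 fun x ↦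
    (differentiableAt_and_fderiv_apply F hF x).1.continuousAt
  have hd : ∀ o x s, HasDerivAt (fun s ↦ eval (fun k ↦ (Φ s x) k) (withNormSq F o))
      (((1 + ‖Φ s x‖ ^ 2) ^ N)⁻¹ * (gramDet F (Φ s x) * Pi.single (M := fun _ ↦ ℝ) none 1 o))
      s := by
    intro o x s
    refine ((hasFDerivAt_eval (withNormSq F o) (Φ s x)).comp_hasDerivAt s (hΦ x s)).congr_deriv ?_
    rw [map_smul, sum_eval_pderiv_smul_proj_apply, gradMatrixAt_mulVec_dualField]
    rfl
  have hQ : ∀ x : EuclideanSpace ℝ (Fin m), 0 < ((1 + ‖x‖ ^ 2) ^ N)⁻¹ := fun x ↦ by positivity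
  have hV : ∀ x ∈ f ⁻¹' {t}, ∀ s, Φ s x ∈ f ⁻¹' {t} := by
    intro x hx s
    rw [mem_preimage, mem_singleton_iff] at hx ⊢
    rw [← hx]
    ext j
    have hconst := is_const_of_deriv_eq_zero (fun s ↦ (hd (some j) x s).differentiableAt)
      (fun s ↦ by rw [(hd (some j) x s).deriv]; simp) s 0
    simpa [withNormSq, hF] using hconst
  obtain ⟨e⟩ := Φ.nonempty_homeomorph_prod_real (h := fun x ↦ ‖x‖ ^ 2)
    (h' := fun x ↦ ((1 + ‖x‖ ^ 2) ^ N)⁻¹ * gramDet F x) (c := r ^ 2) hV (by fun_prop)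
    (((by fun_prop : Continuous fun x : EuclideanSpace ℝ (Fin m) ↦
      (1 + ‖x‖ ^ 2) ^ N).inv₀ fun x ↦ by positivity).mul
      (continuous_det_gradMatrixAt (withNormSq F)))
    (fun x _ s ↦ by simpa [withNormSq, eval_normSq] using hd none x s)
    (fun x _ ↦ mul_nonneg (hQ x).le (Matrix.det_mul_transpose_self_nonneg _))
    (fun x hx hrx ↦ mul_pos (hQ x) (hpos x hx ((sq_le_sq₀ hr (norm_nonneg x)).1 hrx)))
    (fun b ↦ by
      refine Metric.isCompact_of_isClosed_isBounded
        ((isClosed_singleton.preimage hfc).inter (isClosed_Icc.preimage (by fun_prop))) ?_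
      refine (isBounded_closedBall (x := 0) (r := √b)).subset fun x hx ↦ ?_
      rw [mem_closedBall_zero_iff]
      exact Real.le_sqrt_of_sq_le hx.2.2)
  refine ⟨(Homeomorph.setCongr ?_).trans
    (e.trans ((Homeomorph.setCongr ?_).prodCongr (Homeomorph.refl ℝ)))⟩
  · ext x
    simp [← sq_lt_sq₀ hr (norm_nonneg x)]
  · ext x
    simp [sq_eq_sq₀ (norm_nonneg x) hr]

end Fiber

/-- **Lemma 3.3 (Lemma 1).** Let `f : ℝ^m → ℝ^n` be a polynomial map with `m > n` and let
`t0` be a regular value of `f`.  Then there is `R > 0` such that for every `r ≥ R`: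
(1) the fiber `f⁻¹(t0)` is transverse to the sphere `∂B_r`, and
(2) `f⁻¹(t0) ∖ B_r` is homeomorphic to `(f⁻¹(t0) ∩ ∂B_r) × ℝ`. -/
theorem exists_radius_fiber_transverse_and_product_outside
    (m n : ℕ) (hmn : n < m)
    (f : EuclideanSpace ℝ (Fin m) → EuclideanSpace ℝ (Fin n)) (hf : IsPolyMap f)
    (t0 : EuclideanSpace ℝ (Fin n))
    (hreg : ∀ x, f x = t0 → Function.Surjective (fderiv ℝ f x)) :
    ∃ R : ℝ, 0 < R ∧ ∀ r : ℝ, R ≤ r →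
      (∀ x, f x = t0 → ‖x‖ = r →
        Function.Surjective (fderiv ℝ (fun y => (f y, ‖y‖ ^ 2)) x)) ∧
      Nonempty
        (↥(f ⁻¹' {t0} \ Metric.closedBall (0 : EuclideanSpace ℝ (Fin m)) r) ≃ₜ
          ↥(f ⁻¹' {t0} ∩ Metric.sphere (0 : EuclideanSpace ℝ (Fin m)) r) × ℝ) := by
  choose F hF using hf
  obtain ⟨R, hR, hpos⟩ := exists_radius_gramDet_pos F hF t0 hreg
  refine ⟨R, hR, fun r hr ↦ ⟨fun x hx hxr ↦ ?_, ?_⟩⟩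
  · exact fderiv_prodMk_norm_sq_surjective F hF (hpos x hx (hr.trans hxr.ge)).ne'
  · exact nonempty_homeomorph_fiber_sdiff_closedBall F hF t0 (hR.le.trans hr)
      fun x hx hrx ↦ hpos x hx (hr.trans hrx)
end
end
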